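/- arXiv:1809.06599 — 2 statements merged into one kernel-verified Lean document; each statement's English description precedes it below -/
import Mathlib

section
/- Fix integers r, g, 𝔙 ≥ 1 and reals 0 < ε, δ < 1, and set ε₀ := ε/(50g). There exist constants c₀, c₂ > 0 depending only on r, g, 𝔙, ε, δ such that the following holds. Let Q₁, …, Q_r ∈ ℤ[X] be irreducible polynomials, pairwise coprime, such that Q := ∏_{j=1}^r Q_j has degree g, leading coefficient β, and no fixed prime divisor; let D be a nonzero integer divisible by every prime p modulo which Q has a repeated root or modulo which two of the Q_j share a common root. Let M = Σ_{j=1}^r M_j where M_j ≥ 1 satisfies |Σ_{p ≤ t} ρ_j(p)/p − log log t| ≤ M_j for all t ≥ 2. Let x ≥ c₀·‖Q‖^δ, x^ε < y ≤ x, and let f₁, …, f_r be real-valued additive functions such that for every 1 ≤ j ≤ r, every real t ≥ x^{ε₀} and every real u ≥ 1, #{f_j(n) : n ≤ t^u, P⁻(n) > t} ≤ 𝔙^u. Then sup over (k₁,…,k_r) ∈ ℝ^r of #{n ∈ ℤ : x < n ≤ x+y, f_j(Q_j(n)) = k_j for all j} is at least c₂ · e^{−M} · (y/(log x)^r) ·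 sup over (k₁,…,k_r) ∈ ℝ^r of Σ ∏_{j=1}^r ρ_j(a_j)·φ(a_j)/a_j², where the inner sum is over r-tuples (a₁, …, a_r) of positive integers with a_j ≤ x^{ε₀}, f_j(a_j) = k_j for all j, gcd(a_i, a_j) = 1 for all i ≠ j, and gcd(a_j, βD) = 1 for all j. -/
open scoped Classical

/-- The finset of primes `p ≤ x` for a real `x`. -/
noncomputable def primesBelow (x : ℝ) : Finset ℕ :=
  (Finset.range (⌊x⌋₊ + 1)).filter Nat.Prime

/-- `ρ_Q(m) := #{0 ≤ n < m : m ∣ Q(n)}`. -/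
noncomputable def rho (Q : Polynomial ℤ) (m : ℕ) : ℕ :=
  ((Finset.range m).filter fun n => (m : ℤ) ∣ Q.eval (n : ℤ)).card

/-- `‖Q‖` is the maximum of the absolute values of the coefficients of `Q`. -/
noncomputable def polyNorm (Q : Polynomial ℤ) : ℝ :=
  ((Q.support.sup fun i => (Q.coeff i).natAbs : ℕ) : ℝ)

/-- Extension of `f : ℕ → ℝ` to `ℤ` by `f(−n) := f(n)` and `f(0) := 0`. -/
noncomputable def extZ (f : ℕ → ℝ) (n : ℤ) : ℝ := if n = 0 then 0 else f n.natAbs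

/-- Weighted sum over subsets. -/
noncomputable def wSum (P : Finset ℕ) (c : Finset ℕ → ℝ) (h : ℕ → ℝ) : ℝ :=
  ∑ S ∈ P.powerset, c S * ∏ p ∈ S, h p

/-- Sieve product. -/
noncomputable def vProd (P : Finset ℕ) (h : ℕ → ℝ) : ℝ := ∏ p ∈ P, (1 - h p)

/-- Truncated Moebius weight. -/
noncomputable def bonf (k : ℕ) (S : Finset ℕ) : ℝ := if S.card < k then (-1) ^ S.card else 0

/-- Indicator of subsets with exactly `k` elements. -/
noncomputable def layer (k : ℕ) (S : Finset ℕ) : ℝ := if S.card = k then 1 else 0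

lemma wSum_insert (P : Finset ℕ) (a : ℕ) (ha : a ∉ P) (c : Finset ℕ → ℝ) (h : ℕ → ℝ) :
    wSum (insert a P) c h = wSum P c h + h a * wSum P (fun S => c (insert a S)) h := by
  unfold wSum
  rw [Finset.sum_powerset_insert ha, Finset.mul_sum]
  congr 1
  apply Finset.sum_congr rfl
  intro S hS
  have : a ∉ S := fun h' => ha (Finset.mem_powerset.1 hS h')
  rw [Finset.prod_insert this]
  ring

lemma wSum_congr (P : Finset ℕ) (c c' : Finset ℕ → ℝ) (h : ℕ → ℝ)
    (hc : ∀ S ⊆ P, c S = c' S) : wSum P c h = wSum P c' h := by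
  unfold wSum
  apply Finset.sum_congr rfl
  intro S hS
  rw [hc S (Finset.mem_powerset.1 hS)]

lemma wSum_bonf_insert (P : Finset ℕ) (a : ℕ) (ha : a ∉ P) (k : ℕ) (h : ℕ → ℝ) :
    wSum (insert a P) (bonf (k + 1)) h = wSum P (bonf (k + 1)) h - h a * wSum P (bonf k) h := by
  rw [wSum_insert _ _ ha, wSum_congr P (fun S => bonf (k + 1) (insert a S)) (fun S => - bonf k S)]
  · unfold wSum; simp [Finset.sum_neg_distrib]; ring
  · intro S hS
    have : a ∉ S := fun h' => ha (hS h')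
    simp only [bonf, Finset.card_insert_of_notMem this, add_lt_add_iff_right]
    split_ifs <;> simp [pow_succ]

lemma wSum_layer_insert (P : Finset ℕ) (a : ℕ) (ha : a ∉ P) (k : ℕ) (h : ℕ → ℝ) :
    wSum (insert a P) (layer (k + 1)) h = wSum P (layer (k + 1)) h + h a * wSum P (layer k) h := by
  rw [wSum_insert _ _ ha, wSum_congr P (fun S => layer (k + 1) (insert a S)) (fun S => layer k S)]
  intro S hS
  have : a ∉ S := fun h' => ha (hS h')
  simp only [layer, Finset.card_insert_of_notMem this, add_left_inj]

lemma wSum_bonf_zero (P : Finset ℕ) (h : ℕ → ℝ) : wSum P (bonf 0) h = 0 := by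
  simp [wSum, bonf]

lemma wSum_layer_zero (P : Finset ℕ) (h : ℕ → ℝ) : wSum P (layer 0) h = 1 := by
  simp [wSum, layer]

lemma vProd_mem (P : Finset ℕ) (h : ℕ → ℝ) (hh : ∀ p ∈ P, 0 ≤ h p ∧ h p ≤ 1) :
    0 ≤ vProd P h ∧ vProd P h ≤ 1 := by
  constructor
  · exact Finset.prod_nonneg fun p hp => by linarith [(hh p hp).2]
  · exact Finset.prod_le_one (fun p hp => by linarith [(hh p hp).2])
      (fun p hp => by linarith [(hh p hp).1])

/-- Bonferroni inequalities. -/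
lemma bonferroni (P : Finset ℕ) (h : ℕ → ℝ) (hh : ∀ p ∈ P, 0 ≤ h p ∧ h p ≤ 1) (k : ℕ) :
    0 ≤ (-1) ^ k * (vProd P h - wSum P (bonf k) h) ∧
      (-1) ^ k * (vProd P h - wSum P (bonf k) h) ≤ wSum P (layer k) h := by
  induction P using Finset.induction_on generalizing k with
  | empty =>
    rcases k with _ | k
    · simp [wSum, vProd, bonf, layer]
    · simp [wSum, vProd, bonf, layer]
  | insert a P ha ih =>
    have hh' : ∀ p ∈ P, 0 ≤ h p ∧ h p ≤ 1 := fun p hp => hh p (Finset.mem_insert_of_mem hp)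
    have h0 := hh a (Finset.mem_insert_self _ _)
    rcases k with _ | k
    · rw [wSum_bonf_zero, wSum_layer_zero]
      have := vProd_mem _ h hh
      simpa using this
    · rw [wSum_bonf_insert _ _ ha, wSum_layer_insert _ _ ha]
      have h1 := ih hh' k
      have h2 := ih hh' (k + 1)
      have hv : vProd (insert a P) h = (1 - h a) * vProd P h := by
        simp [vProd, Finset.prod_insert ha]
      rw [hv]
      have e : (-1 : ℝ) ^ (k + 1) * ((1 - h a) * vProd P h -
          (wSum P (bonf (k + 1)) h - h a * wSum P (bonf k) h)) =
          (-1) ^ (k + 1) * (vProd P h - wSum P (bonf (k + 1)) h) +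
          h a * ((-1) ^ k * (vProd P h - wSum P (bonf k) h)) := by ring
      rw [e]
      constructor
      · have := mul_nonneg h0.1 h1.1
        linarith [h2.1]
      · have := mul_le_mul_of_nonneg_left h1.2 h0.1
        linarith [h2.2]

lemma layer_le (P : Finset ℕ) (h : ℕ → ℝ) (hh : ∀ p ∈ P, 0 ≤ h p) (k : ℕ) :
    wSum P (layer k) h ≤ (∑ p ∈ P, h p) ^ k / (k.factorial : ℝ) := by
  induction P using Finset.induction_on generalizing k with
  | empty =>
    rcases k with _ | k
    · simp [wSum, layer]
    · simp [wSum, layer]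
  | insert a P ha ih =>
    have hh' : ∀ p ∈ P, 0 ≤ h p := fun p hp => hh p (Finset.mem_insert_of_mem hp)
    have h0 := hh a (Finset.mem_insert_self _ _)
    rcases k with _ | k
    · simp [wSum_layer_zero]
    · rw [wSum_layer_insert _ _ ha, Finset.sum_insert ha]
      set s := ∑ p ∈ P, h p with hs
      have hs0 : 0 ≤ s := Finset.sum_nonneg hh'
      have h1 := ih hh' k
      have h2 := ih hh' (k + 1)
      have h3 := mul_le_mul_of_nonneg_left h1 h0
      have key : s ^ (k + 1) + (k + 1) * (h a * s ^ k) ≤ (h a + s) ^ (k + 1) := by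
        rcases eq_or_lt_of_le hs0 with hz | hz
        · rw [← hz]
          rcases k with _ | k
          · simp
          · simp; positivity
        have hb := one_add_mul_le_pow (a := h a / s) (by have := div_nonneg h0 hz.le; linarith) (k + 1)
        have hb' := mul_le_mul_of_nonneg_left hb (pow_nonneg hz.le (k + 1))
        rw [← mul_pow] at hb'
        have e1 : s * (1 + h a / s) = h a + s := by field_simp; ring
        rw [e1] at hb'
        refine le_trans (le_of_eq ?_) hb'
        push_cast
        field_simp
        ring
      have hf : ((k + 1).factorial : ℝ) = (k + 1) * k.factorial := by
        rw [Nat.factorial_succ]; push_cast; ring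
      have hfp : (0 : ℝ) < k.factorial := by positivity
      calc _ ≤ s ^ (k + 1) / ((k + 1).factorial : ℝ) + h a * (s ^ k / k.factorial) := add_le_add h2 h3
        _ = (s ^ (k + 1) + (k + 1) * (h a * s ^ k)) / ((k + 1).factorial : ℝ) := by
          rw [hf]; field_simp
        _ ≤ _ := by gcongr

lemma sum_powerset_union (P B : Finset ℕ) (hd : Disjoint P B) (F G : Finset ℕ → ℝ) :
    ∑ S ∈ (P ∪ B).powerset, F (S ∩ P) * G (S ∩ B) =
      (∑ S ∈ P.powerset, F S) * ∑ S ∈ B.powerset, G S := by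
  rw [Finset.sum_mul_sum, ← Finset.sum_product']
  refine Finset.sum_bij' (fun S _ => (S ∩ P, S ∩ B)) (fun T _ => T.1 ∪ T.2) ?_ ?_ ?_ ?_ ?_
  · intro S _
    simp
  · intro T hT
    simp only [Finset.mem_product, Finset.mem_powerset] at hT ⊢
    exact Finset.union_subset_union hT.1 hT.2
  · intro S hS
    simp only [Finset.mem_powerset] at hS
    simp only [← Finset.inter_union_distrib_left]
    exact Finset.inter_eq_left.2 hS
  · intro T hT
    simp only [Finset.mem_product, Finset.mem_powerset] at hT
    have hd' : ∀ a, a ∈ P → a ∉ B := fun a h1 h2 => Finset.disjoint_left.1 hd h1 h2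
    ext a
    · simp only [Finset.mem_inter, Finset.mem_union]
      constructor
      · rintro ⟨h | h, h'⟩
        · exact h
        · exact absurd (hT.2 h) (hd' a h')
      · intro h; exact ⟨Or.inl h, hT.1 h⟩
    · simp only [Finset.mem_inter, Finset.mem_union]
      constructor
      · rintro ⟨h | h, h'⟩
        · exact absurd h' (hd' a (hT.1 h))
        · exact h
      · intro h; exact ⟨Or.inr h, hT.2 h⟩
  · intro S _
    rfl

lemma wSum_union (P B : Finset ℕ) (hd : Disjoint P B) (c d : Finset ℕ → ℝ) (h : ℕ → ℝ) :
    wSum (P ∪ B) (fun S => c (S ∩ P) * d (S ∩ B)) h = wSum P c h * wSum B d h := by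
  unfold wSum
  rw [← sum_powerset_union P B hd (fun S => c S * ∏ p ∈ S, h p) (fun S => d S * ∏ p ∈ S, h p)]
  apply Finset.sum_congr rfl
  intro S hS
  have hS' := Finset.mem_powerset.1 hS
  have : ∏ p ∈ S, h p = (∏ p ∈ S ∩ P, h p) * ∏ p ∈ S ∩ B, h p := by
    rw [← Finset.prod_union, ← Finset.inter_union_distrib_left, Finset.inter_eq_left.2 hS']
    exact hd.mono Finset.inter_subset_right Finset.inter_subset_right
  rw [this]; ring

/-- Existence of good upper and lower sieve weights. -/
def SieveState (P : Finset ℕ) (δ : ℕ → ℝ) (Lev u f : ℝ) : Prop :=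
  ∃ cU cF : Finset ℕ → ℝ, (∀ S, |cU S| ≤ 1) ∧ (∀ S, |cF S| ≤ 1) ∧
    (∀ S ⊆ P, cU S ≠ 0 → ∏ p ∈ S, (p : ℝ) ≤ Lev) ∧
    (∀ S ⊆ P, cF S ≠ 0 → ∏ p ∈ S, (p : ℝ) ≤ Lev) ∧
    (∀ h : ℕ → ℝ, (∀ p ∈ P, 0 ≤ h p ∧ h p ≤ 1) →
      wSum P cF h ≤ vProd P h ∧ vProd P h ≤ wSum P cU h) ∧
    wSum P cU δ ≤ u * vProd P δ ∧ f * vProd P δ ≤ wSum P cF δ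

lemma vProd_union (P B : Finset ℕ) (hd : Disjoint P B) (h : ℕ → ℝ) :
    vProd (P ∪ B) h = vProd P h * vProd B h := Finset.prod_union hd

lemma prod_le_pow_real (S : Finset ℕ) (z : ℝ) (hz : 1 ≤ z) (hS : ∀ p ∈ S, (p : ℝ) ≤ z) (k : ℕ)
    (hk : S.card ≤ k) : ∏ p ∈ S, (p : ℝ) ≤ z ^ k := by
  calc ∏ p ∈ S, (p : ℝ) ≤ ∏ _p ∈ S, z := Finset.prod_le_prod (fun _ _ => by positivity) hS
    _ = z ^ S.card := by simp
    _ ≤ z ^ k := pow_le_pow_right₀ hz hk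

lemma SieveState.step (P B : Finset ℕ) (hd : Disjoint P B) (δ : ℕ → ℝ)
    (hδ : ∀ p ∈ P ∪ B, 0 ≤ δ p ∧ δ p ≤ 1) (Lev u f : ℝ) (hLev : 0 ≤ Lev)
    (hu : 0 ≤ u) (hf : 0 ≤ f) (m : ℕ) (hm : Odd m) (ε : ℝ)
    (hε : wSum B (layer m) δ ≤ ε * vProd B δ) (z : ℝ) (hz : 1 ≤ z) (hB : ∀ p ∈ B, (p : ℝ) ≤ z)
    (hs : SieveState P δ Lev u f) :
    SieveState (P ∪ B) δ (Lev * z ^ m) (u * (1 + ε)) (f - ε * u) := by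
  obtain ⟨cU, cF, hU1, hF1, hUs, hFs, hpt, hUm, hFm⟩ := hs
  have hsub : ∀ S ⊆ P ∪ B, ∏ p ∈ S, (p : ℝ) = (∏ p ∈ S ∩ P, (p : ℝ)) * ∏ p ∈ S ∩ B, (p : ℝ) := by
    intro S hS
    rw [← Finset.prod_union, ← Finset.inter_union_distrib_left, Finset.inter_eq_left.2 hS]
    exact hd.mono Finset.inter_subset_right Finset.inter_subset_right
  have hsupp : ∀ S ⊆ P ∪ B, (∏ p ∈ S ∩ P, (p : ℝ) ≤ Lev) → (S ∩ B).card ≤ m →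
      ∏ p ∈ S, (p : ℝ) ≤ Lev * z ^ m := by
    intro S hS h1 h2
    rw [hsub S hS]
    exact mul_le_mul h1 (prod_le_pow_real _ z hz
      (fun p hp => hB p (Finset.mem_inter.1 hp).2) m h2)
      (Finset.prod_nonneg fun _ _ => by positivity) hLev
  have hbonf1 : ∀ S, |bonf m S| ≤ 1 := by
    intro S; unfold bonf; split_ifs <;> simp [abs_pow]
  have hB0 : ∀ h : ℕ → ℝ, (∀ p ∈ P ∪ B, 0 ≤ h p ∧ h p ≤ 1) →
      vProd B h ≤ wSum B (bonf m) h ∧ wSum B (bonf m) h - wSum B (layer m) h ≤ vProd B h := by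
    intro h hh
    have := bonferroni B h (fun p hp => hh p (Finset.mem_union_right _ hp)) m
    rw [hm.neg_one_pow] at this
    constructor <;> linarith [this.1, this.2]
  have hl0 : ∀ h : ℕ → ℝ, (∀ p ∈ P ∪ B, 0 ≤ h p ∧ h p ≤ 1) → 0 ≤ wSum B (layer m) h := by
    intro h hh
    have := hB0 h hh
    linarith [this.1, this.2]
  let cF' : Finset ℕ → ℝ := fun S =>
    cF (S ∩ P) * bonf m (S ∩ B) - cU (S ∩ P) * layer m (S ∩ B)
  have hcF' : ∀ h, wSum (P ∪ B) cF' h =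
      wSum P cF h * wSum B (bonf m) h - wSum P cU h * wSum B (layer m) h := by
    intro h
    rw [← wSum_union P B hd, ← wSum_union P B hd]
    unfold wSum
    rw [← Finset.sum_sub_distrib]
    apply Finset.sum_congr rfl
    intro S _
    simp only [cF']; ring
  refine ⟨fun S => cU (S ∩ P) * bonf m (S ∩ B), cF', ?_, ?_, ?_, ?_, ?_, ?_, ?_⟩
  · intro S
    rw [abs_mul]
    exact mul_le_one₀ (hU1 _) (abs_nonneg _) (hbonf1 _)
  · intro S
    simp only [cF', bonf, layer]
    by_cases h1 : (S ∩ B).card = m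
    · simp [h1, hU1]
    · by_cases h2 : (S ∩ B).card < m
      · simp [h1, h2, abs_mul, abs_pow, hF1]
      · simp [h1, h2]
  · intro S hS hne
    have h1 : cU (S ∩ P) ≠ 0 := left_ne_zero_of_mul hne
    have h2 : bonf m (S ∩ B) ≠ 0 := right_ne_zero_of_mul hne
    refine hsupp S hS (hUs _ Finset.inter_subset_right h1) ?_
    by_contra hc
    exact h2 (by simp [bonf]; omega)
  · intro S hS hne
    simp only [cF', bonf, layer] at hne
    by_cases h1 : (S ∩ B).card = m
    · simp [h1] at hne
      exact hsupp S hS (hUs _ Finset.inter_subset_right hne) h1.le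
    · by_cases h2 : (S ∩ B).card < m
      · simp [h1, h2] at hne
        exact hsupp S hS (hFs _ Finset.inter_subset_right hne) h2.le
      · simp [h1, h2] at hne
  · intro h hh
    rw [hcF', wSum_union P B hd, vProd_union P B hd]
    have hp := hpt h (fun p hp => hh p (Finset.mem_union_left _ hp))
    have hb := hB0 h hh
    have hl := hl0 h hh
    have hvP := vProd_mem P h (fun p hp => hh p (Finset.mem_union_left _ hp))
    have hvB := vProd_mem B h (fun p hp => hh p (Finset.mem_union_right _ hp))
    constructor
    · nlinarith [mul_le_mul_of_nonneg_right hp.1 (hvB.1.trans hb.1),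
        mul_le_mul_of_nonneg_right hp.2 hl, mul_le_mul_of_nonneg_left hb.2 hvP.1]
    · exact mul_le_mul hp.2 hb.1 hvB.1 (hvP.1.trans hp.2)
  · rw [wSum_union P B hd, vProd_union P B hd]
    have hb := hB0 δ hδ
    have hvP := vProd_mem P δ (fun p hp => hδ p (Finset.mem_union_left _ hp))
    have hvB := vProd_mem B δ (fun p hp => hδ p (Finset.mem_union_right _ hp))
    calc wSum P cU δ * wSum B (bonf m) δ ≤ (u * vProd P δ) * ((1 + ε) * vProd B δ) := by
          apply mul_le_mul hUm _ (hvB.1.trans hb.1) (mul_nonneg hu hvP.1)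
          linarith [hb.2]
      _ = _ := by ring
  · rw [hcF', vProd_union P B hd]
    have hb := hB0 δ hδ
    have hl := hl0 δ hδ
    have hvP := vProd_mem P δ (fun p hp => hδ p (Finset.mem_union_left _ hp))
    have hvB := vProd_mem B δ (fun p hp => hδ p (Finset.mem_union_right _ hp))
    have h1 : (f * vProd P δ) * vProd B δ ≤ wSum P cF δ * wSum B (bonf m) δ :=
      mul_le_mul hFm hb.1 hvB.1 ((mul_nonneg hf hvP.1).trans hFm)
    have h2 : wSum P cU δ * wSum B (layer m) δ ≤ (u * vProd P δ) * (ε * vProd B δ) :=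
      mul_le_mul hUm hε hl (mul_nonneg hu hvP.1)
    linarith

/-- Exact inclusion-exclusion as the base of the construction. -/
lemma SieveState.base (P : Finset ℕ) (δ : ℕ → ℝ) (hP : ∀ p ∈ P, 1 ≤ p) :
    SieveState P δ (∏ p ∈ P, (p : ℝ)) 1 1 := by
  have hw : ∀ h, wSum P (fun S => (-1) ^ S.card) h = vProd P h := by
    intro h
    unfold wSum vProd
    simp only [sub_eq_add_neg, Finset.prod_one_add, Finset.prod_neg]
  have hsup : ∀ S ⊆ P, ∏ p ∈ S, (p : ℝ) ≤ ∏ p ∈ P, (p : ℝ) := by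
    intro S hS
    apply Finset.prod_le_prod_of_subset_of_one_le hS
    · intro i _; positivity
    · intro i hi _; exact_mod_cast hP i hi
  refine ⟨fun S => (-1) ^ S.card, fun S => (-1) ^ S.card, ?_, ?_, ?_, ?_, ?_, ?_, ?_⟩
  · intro S; simp [abs_pow]
  · intro S; simp [abs_pow]
  · intro S hS _; exact hsup S hS
  · intro S hS _; exact hsup S hS
  · intro h _; rw [hw]; simp
  · rw [hw]; simp
  · rw [hw]; simp

/-- Integers in `(x, x+y]`. -/
noncomputable def intI (x y : ℝ) : Finset ℤ := Finset.Ioc ⌊x⌋ ⌊x + y⌋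

lemma mem_intI (x y : ℝ) (n : ℤ) : n ∈ intI x y ↔ x < n ∧ (n : ℝ) ≤ x + y := by
  simp [intI, Int.floor_lt, Int.le_floor]

lemma card_AP (x y : ℝ) (hy : 0 ≤ y) (q : ℕ) (hq : 1 ≤ q) (b : ℤ) :
    |(((intI x y).filter fun n => n ≡ b [ZMOD q]).card : ℝ) - y / q| ≤ 1 := by
  have hq0 : (0 : ℤ) < q := by exact_mod_cast hq
  have hq1 : (0 : ℝ) < q := by exact_mod_cast hq
  have h := Int.Ioc_filter_modEq_card ⌊x⌋ ⌊x + y⌋ hq0 b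
  have key : ∀ t : ℝ, (⌊((⌊t⌋ - b : ℤ) : ℚ) / ((q : ℤ) : ℚ)⌋ : ℤ) ≤ (t - b) / q ∧
      (t - b) / q < (⌊((⌊t⌋ - b : ℤ) : ℚ) / ((q : ℤ) : ℚ)⌋ : ℤ) + 1 := by
    intro t
    have e : ⌊((⌊t⌋ - b : ℤ) : ℚ) / ((q : ℤ) : ℚ)⌋ = (⌊t⌋ - b) / (q : ℤ) :=
      Rat.floor_intCast_div_natCast (⌊t⌋ - b) q
    rw [e]
    have h1 := Int.ediv_mul_le (⌊t⌋ - b) hq0.ne'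
    have h2 := Int.lt_ediv_add_one_mul_self (⌊t⌋ - b) hq0
    set A := (⌊t⌋ - b) / (q : ℤ)
    constructor
    · rw [le_div_iff₀ hq1]
      have h3 : ((A * q : ℤ) : ℝ) ≤ ((⌊t⌋ - b : ℤ) : ℝ) := by exact_mod_cast h1
      push_cast at h3
      linarith [Int.floor_le t]
    · rw [div_lt_iff₀ hq1]
      have h4 : ⌊t⌋ + 1 ≤ (A + 1) * q + b := by linarith
      have h3 : ((⌊t⌋ + 1 : ℤ) : ℝ) ≤ (((A + 1) * q + b : ℤ) : ℝ) := by exact_mod_cast h4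
      push_cast at h3
      linarith [Int.lt_floor_add_one t]
  have k1 := key x
  have k2 := key (x + y)
  unfold intI
  simp only [Int.cast_sub] at k1 k2 h
  rw [show (((Finset.Ioc ⌊x⌋ ⌊x + y⌋).filter fun n => n ≡ b [ZMOD q]).card : ℝ) =
    ((((Finset.Ioc ⌊x⌋ ⌊x + y⌋).filter fun n => n ≡ b [ZMOD q]).card : ℤ) : ℝ) by push_cast; rfl, h]
  set A := ⌊((⌊x⌋ : ℚ) - (b : ℚ)) / ((q : ℤ) : ℚ)⌋
  set B := ⌊((⌊x + y⌋ : ℚ) - (b : ℚ)) / ((q : ℤ) : ℚ)⌋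
  have e2 : (x + y - b) / q = (x - b) / q + y / q := by field_simp; ring
  have hyq : 0 ≤ y / q := by positivity
  have h6 : A < B + 1 := by
    have : (A : ℝ) < B + 1 := by linarith [k1.1, k2.2]
    exact_mod_cast this
  rw [max_eq_left (by omega)]
  push_cast
  rw [abs_le]
  constructor <;> linarith [k1.1, k1.2, k2.1, k2.2]

/-- Roots of `Q` modulo `m` in `{0, …, m-1}`. -/
noncomputable def rootsMod (Q : Polynomial ℤ) (m : ℕ) : Finset ℕ :=
  (Finset.range m).filter fun n : ℕ => (m : ℤ) ∣ Q.eval (n : ℤ)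

lemma mem_rootsMod (Q : Polynomial ℤ) (m n : ℕ) :
    n ∈ rootsMod Q m ↔ n < m ∧ (m : ℤ) ∣ Q.eval (n : ℤ) := by
  simp [rootsMod]

lemma rho_eq (Q : Polynomial ℤ) (m : ℕ) : rho Q m = (rootsMod Q m).card := by
  unfold rho
  symm
  apply Finset.card_bij (fun (n : ℕ) _ => (n : ℤ))
  · intro n hn
    rw [mem_rootsMod] at hn
    simp [hn.1, hn.2]
  · intro a _ b _ h
    exact_mod_cast h
  · intro b hb
    simp at hb
    obtain ⟨⟨n, hn, rfl⟩, h2⟩ := hb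
    exact ⟨n, (mem_rootsMod _ _ _).2 ⟨hn, h2⟩, rfl⟩

lemma eval_dvd_congr (Q : Polynomial ℤ) (m : ℤ) {a b : ℤ} (h : a ≡ b [ZMOD m]) :
    m ∣ Q.eval a ↔ m ∣ Q.eval b := by
  have h1 : m ∣ b - a := Int.modEq_iff_dvd.1 h
  have h2 : m ∣ Q.eval b - Q.eval a := h1.trans (Polynomial.sub_dvd_eval_sub b a Q)
  constructor
  · intro h3; have := dvd_add h2 h3; simpa using this
  · intro h3; have := dvd_sub h3 h2; simpa using this

lemma int_crt (q a : ℕ) (h : Nat.Coprime q a) (b r : ℤ) :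
    ∃ c : ℤ, ∀ n : ℤ, (n ≡ b [ZMOD q] ∧ n ≡ r [ZMOD a]) ↔ n ≡ c [ZMOD ((q * a : ℕ) : ℤ)] := by
  have hc : IsCoprime (q : ℤ) (a : ℤ) := Nat.isCoprime_iff_coprime.2 h
  obtain ⟨u, v, huv⟩ := hc
  refine ⟨b * (v * a) + r * (u * q), fun n => ?_⟩
  have hcq : b * (v * a) + r * (u * q) ≡ b [ZMOD q] := by
    apply Int.modEq_iff_dvd.2
    exact ⟨(b - r) * u, by linear_combination b * (-huv)⟩
  have hca : b * (v * a) + r * (u * q) ≡ r [ZMOD a] := by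
    apply Int.modEq_iff_dvd.2
    exact ⟨(r - b) * v, by linear_combination r * (-huv)⟩
  push_cast
  constructor
  · rintro ⟨h1, h2⟩
    apply (Int.modEq_and_modEq_iff_modEq_mul (by simpa using h)).1
    exact ⟨h1.trans hcq.symm, h2.trans hca.symm⟩
  · intro h1
    exact ⟨(h1.of_mul_right _).trans hcq, (h1.of_mul_left _).trans hca⟩

lemma card_AP_S (Q : Polynomial ℤ) (x y : ℝ) (hy : 0 ≤ y) (S : Finset ℕ)
    (hS : ∀ p ∈ S, p.Prime) : ∀ (q : ℕ), 1 ≤ q → (∀ p ∈ S, Nat.Coprime q p) → ∀ b : ℤ,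
    |(((intI x y).filter fun n => n ≡ b [ZMOD q] ∧ ∀ p ∈ S, (p : ℤ) ∣ Q.eval n).card : ℝ) -
      y / q * ∏ p ∈ S, ((rho Q p : ℝ) / p)| ≤ ∏ p ∈ S, (rho Q p : ℝ) := by
  induction S using Finset.induction_on with
  | empty =>
    intro q hq _ b
    simpa using card_AP x y hy q hq b
  | insert a S ha ih =>
    intro q hq hc b
    have hap : a.Prime := hS a (Finset.mem_insert_self _ _)
    have ha1 : 1 ≤ a := hap.one_lt.le
    have hS' : ∀ p ∈ S, p.Prime := fun p hp => hS p (Finset.mem_insert_of_mem hp)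
    have hqa := hc a (Finset.mem_insert_self _ _)
    choose c hcr using fun r : ℕ => int_crt q a hqa b (r : ℤ)
    set R := rootsMod Q a with hR
    have hrho : rho Q a = R.card := rho_eq Q a
    have hsplit : ((intI x y).filter fun n => n ≡ b [ZMOD q] ∧ ∀ p ∈ insert a S, (p : ℤ) ∣ Q.eval n) =
        R.biUnion fun r => (intI x y).filter fun n =>
          n ≡ c r [ZMOD ((q * a : ℕ) : ℤ)] ∧ ∀ p ∈ S, (p : ℤ) ∣ Q.eval n := by
      ext n
      simp only [Finset.mem_filter, Finset.mem_biUnion, ← hcr, Finset.forall_mem_insert, hR,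
        mem_rootsMod]
      constructor
      · rintro ⟨h1, h2, h3, h4⟩
        have hpos : (0 : ℤ) < a := by exact_mod_cast ha1
        have e1 : ((n % a).toNat : ℤ) = n % a := Int.toNat_of_nonneg (Int.emod_nonneg _ hpos.ne')
        have e2 : n ≡ ((n % a).toNat : ℤ) [ZMOD a] := by rw [e1]; exact (Int.mod_modEq n a).symm
        refine ⟨(n % a).toNat, ⟨?_, ?_⟩, h1, ⟨h2, e2⟩, h4⟩
        · have := Int.emod_lt_of_pos n hpos
          omega
        · exact (eval_dvd_congr Q a e2).1 h3
      · rintro ⟨r, ⟨h1, h2⟩, h3, ⟨h4, h5⟩, h6⟩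
        exact ⟨h3, h4, (eval_dvd_congr Q a h5).2 h2, h6⟩
    have hdisj : ∀ r ∈ R, ∀ r' ∈ R, r ≠ r' → Disjoint
        ((intI x y).filter fun n =>
          n ≡ c r [ZMOD ((q * a : ℕ) : ℤ)] ∧ ∀ p ∈ S, (p : ℤ) ∣ Q.eval n)
        ((intI x y).filter fun n =>
          n ≡ c r' [ZMOD ((q * a : ℕ) : ℤ)] ∧ ∀ p ∈ S, (p : ℤ) ∣ Q.eval n) := by
      intro r hr r' hr' hne
      rw [Finset.disjoint_left]
      intro n h1 h2
      simp only [Finset.mem_filter, ← hcr] at h1 h2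
      have h3 : (r : ℤ) ≡ r' [ZMOD a] := h1.2.1.2.symm.trans h2.2.1.2
      have h4 := (Int.natCast_modEq_iff).1 h3
      simp only [hR, mem_rootsMod] at hr hr'
      exact hne (Nat.ModEq.eq_of_lt_of_lt h4 hr.1 hr'.1)
    rw [hsplit, Finset.card_biUnion hdisj, Finset.prod_insert ha, Finset.prod_insert ha, hrho]
    push_cast
    have hq' : 1 ≤ q * a := Nat.mul_pos hq ha1
    have hcop : ∀ p ∈ S, Nat.Coprime (q * a) p := by
      intro p hp
      apply Nat.Coprime.mul_left (hc p (Finset.mem_insert_of_mem hp))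
      rw [Nat.coprime_primes hap (hS' p hp)]
      rintro rfl; exact ha hp
    have hall := fun r => ih hS' (q * a) hq' hcop (c r)
    have e : y / q * ((R.card : ℝ) / a * ∏ p ∈ S, ((rho Q p : ℝ) / p)) =
        ∑ _r ∈ R, y / ((q * a : ℕ) : ℝ) * ∏ p ∈ S, ((rho Q p : ℝ) / p) := by
      rw [Finset.sum_const, nsmul_eq_mul]
      push_cast
      have : (a : ℝ) ≠ 0 := by exact_mod_cast hap.ne_zero
      have : (q : ℝ) ≠ 0 := by positivity
      field_simp
    push_cast at e hall ⊢
    rw [e, ← Finset.sum_sub_distrib]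
    refine (Finset.abs_sum_le_sum_abs _ _).trans ?_
    refine (Finset.sum_le_sum fun r _ => hall r).trans ?_
    simp

lemma sum_supp_le (P : Finset ℕ) (hP : ∀ p ∈ P, p.Prime) (F : Finset (Finset ℕ)) (hF : F ⊆ P.powerset)
    (Lev : ℝ) (hLev : 0 ≤ Lev) (h : ∀ S ∈ F, ∏ p ∈ S, (p : ℝ) ≤ Lev) :
    ∑ S ∈ F, ∏ p ∈ S, (p : ℝ) ≤ Lev ^ 2 := by
  have hcard : (F.card : ℝ) ≤ Lev := by
    have h1 : F.card ≤ (Finset.Icc 1 ⌊Lev⌋₊).card := by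
      apply Finset.card_le_card_of_injOn (fun S => ∏ p ∈ S, p)
      · intro S hS
        have hS' := h S hS
        simp only [Finset.coe_Icc, Set.mem_Icc]
        constructor
        · apply Nat.succ_le_of_lt
          apply Finset.prod_pos
          intro p hp
          exact (hP p (Finset.mem_powerset.1 (hF hS) hp)).pos
        · apply Nat.le_floor
          push_cast
          exact hS'
      · intro S hS T hT hST
        have e1 := Nat.primeFactors_prod (s := S)
          (fun p hp => hP p (Finset.mem_powerset.1 (hF hS) hp))
        have e2 := Nat.primeFactors_prod (s := T)
          (fun p hp => hP p (Finset.mem_powerset.1 (hF hT) hp))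
        simp only at hST
        rw [← e1, ← e2, hST]
    simp only [Nat.card_Icc, Nat.add_sub_cancel] at h1
    exact (Nat.cast_le.2 h1).trans (Nat.floor_le hLev)
  calc ∑ S ∈ F, ∏ p ∈ S, (p : ℝ) ≤ ∑ _S ∈ F, Lev := Finset.sum_le_sum h
    _ = F.card * Lev := by simp
    _ ≤ Lev * Lev := by gcongr
    _ = Lev ^ 2 := by ring

lemma rho_le (Q : Polynomial ℤ) (m : ℕ) : rho Q m ≤ m := by
  rw [rho_eq]
  exact (Finset.card_filter_le _ _).trans (by simp)

lemma sieve_count (Q : Polynomial ℤ) (x y : ℝ) (hy : 0 ≤ y) (P : Finset ℕ)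
    (hP : ∀ p ∈ P, p.Prime) (q : ℕ) (hq : 1 ≤ q) (hc : ∀ p ∈ P, Nat.Coprime q p) (b : ℤ)
    (Lev u f : ℝ) (hLev : 0 ≤ Lev)
    (hs : SieveState P (fun p => (rho Q p : ℝ) / p) Lev u f) :
    y / q * (f * vProd P (fun p => (rho Q p : ℝ) / p)) - Lev ^ 2 ≤
      (((intI x y).filter fun n => n ≡ b [ZMOD q] ∧ ∀ p ∈ P, ¬ (p : ℤ) ∣ Q.eval n).card : ℝ) := by
  obtain ⟨cU, c, -, hc1, -, hsupp, hpt, -, hm⟩ := hs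
  set δ : ℕ → ℝ := fun p => (rho Q p : ℝ) / p with hδ
  set J := (intI x y).filter fun n => n ≡ b [ZMOD q] with hJ
  let h : ℤ → ℕ → ℝ := fun n p => if (p : ℤ) ∣ Q.eval n then 1 else 0
  have h01 : ∀ n, ∀ p ∈ P, 0 ≤ h n p ∧ h n p ≤ 1 := by
    intro n p _; simp only [h]; split_ifs <;> norm_num
  have hcount : (((intI x y).filter fun n => n ≡ b [ZMOD q] ∧ ∀ p ∈ P, ¬ (p : ℤ) ∣ Q.eval n).card : ℝ)
      = ∑ n ∈ J, vProd P (h n) := by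
    rw [← Finset.filter_filter, Finset.card_filter, Nat.cast_sum]
    apply Finset.sum_congr rfl
    intro n _
    unfold vProd
    by_cases hn : ∀ p ∈ P, ¬ (p : ℤ) ∣ Q.eval n
    · simp only [h]
      rw [Finset.prod_congr rfl (g := fun _ => (1 : ℝ))]
      · simp
        exact hn
      · intro p hp; simp [hn p hp]
    · rw [if_neg hn]
      push Not at hn
      obtain ⟨p, hp, hd⟩ := hn
      symm
      rw [Nat.cast_zero]
      apply Finset.prod_eq_zero hp
      simp [h, hd]
  rw [hcount]
  have h1 : ∑ n ∈ J, wSum P c (h n) ≤ ∑ n ∈ J, vProd P (h n) :=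
    Finset.sum_le_sum fun n _ => (hpt (h n) (h01 n)).1
  refine le_trans ?_ h1
  unfold wSum
  rw [Finset.sum_comm]
  have h2 : ∀ S ∈ P.powerset, ∑ n ∈ J, c S * ∏ p ∈ S, h n p = c S *
      (((intI x y).filter fun n => n ≡ b [ZMOD q] ∧ ∀ p ∈ S, (p : ℤ) ∣ Q.eval n).card : ℝ) := by
    intro S _
    rw [← Finset.mul_sum, ← Finset.filter_filter, Finset.card_filter, Nat.cast_sum]
    congr 1
    apply Finset.sum_congr rfl
    intro n _
    simp only [h]
    rw [Finset.prod_ite_zero]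
    simp
  rw [Finset.sum_congr rfl h2]
  have h3 : ∀ S ∈ P.powerset, y / q * (c S * ∏ p ∈ S, δ p) -
      (if c S ≠ 0 then ∏ p ∈ S, (p : ℝ) else 0) ≤ c S *
      (((intI x y).filter fun n => n ≡ b [ZMOD q] ∧ ∀ p ∈ S, (p : ℤ) ∣ Q.eval n).card : ℝ) := by
    intro S hS
    have hSP := Finset.mem_powerset.1 hS
    by_cases h0 : c S = 0
    · simp [h0]
    · rw [if_pos h0]
      have h4 := card_AP_S Q x y hy S (fun p hp => hP p (hSP hp)) q hq (fun p hp => hc p (hSP hp)) b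
      have h5 : ∏ p ∈ S, (rho Q p : ℝ) ≤ ∏ p ∈ S, (p : ℝ) :=
        Finset.prod_le_prod (fun _ _ => by positivity) (fun p _ => by exact_mod_cast rho_le Q p)
      set N := (((intI x y).filter fun n => n ≡ b [ZMOD q] ∧
        ∀ p ∈ S, (p : ℤ) ∣ Q.eval n).card : ℝ)
      have h6 : |c S * (N - y / q * ∏ p ∈ S, δ p)| ≤ ∏ p ∈ S, (p : ℝ) := by
        rw [abs_mul]
        calc |c S| * _ ≤ 1 * ∏ p ∈ S, (p : ℝ) :=
              mul_le_mul (hc1 S) (h4.trans h5) (abs_nonneg _) zero_le_one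
          _ = _ := one_mul _
      have := (abs_le.1 h6).1
      linarith
  refine le_trans ?_ (Finset.sum_le_sum h3)
  rw [Finset.sum_sub_distrib, ← Finset.mul_sum, ← Finset.sum_filter]
  have h7 := sum_supp_le P hP (P.powerset.filter fun S => c S ≠ 0) (Finset.filter_subset _ _) Lev hLev
    (by
      intro S hS
      rw [Finset.mem_filter, Finset.mem_powerset] at hS
      exact hsupp S hS.1 hS.2)
  have h8 : y / q * (f * vProd P δ) ≤ y / q * ∑ S ∈ P.powerset, c S * ∏ p ∈ S, δ p :=
    mul_le_mul_of_nonneg_left hm (by positivity)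
  linarith

lemma prod_pow_dvd_factorial (N : ℕ) :
    (∏ p ∈ Nat.primesLE N, p ^ (N / p)) ∣ N.factorial := by
  apply Finset.prod_dvd_of_isRelPrime
  · intro p hp q hq hpq
    have hp' := (Nat.mem_primesLE.1 hp).2
    have hq' := (Nat.mem_primesLE.1 hq).2
    exact Nat.coprime_iff_isRelPrime.1
      (Nat.Coprime.pow _ _ ((Nat.coprime_primes hp' hq').2 hpq))
  · intro p hp
    have hp' := (Nat.mem_primesLE.1 hp).2
    rw [Nat.Prime.pow_dvd_factorial_iff hp' (b := Nat.log p N + 2) (by omega)]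
    have h1 : (1 : ℕ) ∈ Finset.Ico 1 (Nat.log p N + 2) := by simp
    have := Finset.single_le_sum (f := fun i => N / p ^ i) (fun i _ => Nat.zero_le _) h1
    simpa using this

lemma sum_log_div (N : ℕ) (hN : 1 ≤ N) :
    ∑ p ∈ Nat.primesLE N, Real.log p / p ≤ Real.log N + Real.log 4 := by
  have hN0 : (0 : ℝ) < N := by exact_mod_cast hN
  have h1 : (∏ p ∈ Nat.primesLE N, p ^ (N / p)) ≤ N ^ N :=
    (Nat.le_of_dvd (Nat.factorial_pos N) (prod_pow_dvd_factorial N)).trans (Nat.factorial_le_pow N)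
  have h2 : Real.log (((∏ p ∈ Nat.primesLE N, p ^ (N / p) : ℕ)) : ℝ) ≤ Real.log ((N ^ N : ℕ) : ℝ) := by
    apply Real.log_le_log
    · have : 0 < ∏ p ∈ Nat.primesLE N, p ^ (N / p) :=
        Finset.prod_pos fun p hp => pow_pos (Nat.mem_primesLE.1 hp).2.pos _
      exact_mod_cast this
    · exact_mod_cast h1
  push_cast at h2
  rw [Real.log_pow, Real.log_prod (by
    intro p hp
    have := (Nat.mem_primesLE.1 hp).2.ne_zero
    positivity)] at h2
  have h3 := Chebyshev.theta_le_log4_mul_x (x := (N : ℝ)) hN0.le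
  rw [Chebyshev.theta_eq_sum_primesLE_log] at h3
  have h4 : ∑ p ∈ Nat.primesLE N, (N * (Real.log p / p) - Real.log p) ≤
      ∑ p ∈ Nat.primesLE N, Real.log ((p : ℝ) ^ (N / p)) := by
    apply Finset.sum_le_sum
    intro p hp
    have hp' := (Nat.mem_primesLE.1 hp).2
    have hp0 : (0 : ℝ) < p := by exact_mod_cast hp'.pos
    rw [Real.log_pow]
    have hl : 0 ≤ Real.log p := Real.log_nonneg (by exact_mod_cast hp'.one_lt.le)
    have h5 : (N : ℝ) / p < (N / p : ℕ) + 1 := by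
      rw [div_lt_iff₀ hp0]
      have := Nat.lt_div_mul_add (a := N) hp'.pos
      have h6 : N < (N / p + 1) * p := by linarith
      exact_mod_cast h6
    have h7 : (N : ℝ) * (Real.log p / p) - Real.log p = ((N : ℝ) / p - 1) * Real.log p := by
      field_simp
    rw [h7]
    apply mul_le_mul_of_nonneg_right _ hl
    linarith
  rw [Finset.sum_sub_distrib, ← Finset.mul_sum] at h4
  have h8 : N * ∑ p ∈ Nat.primesLE N, Real.log p / p ≤ N * (Real.log N + Real.log 4) := by
    linarith
  exact le_of_mul_le_mul_left h8 hN0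

lemma sum_inv_block (w : ℝ) (hw : 1 < w) (B : Finset ℕ)
    (hB : ∀ p ∈ B, p.Prime ∧ w < p ∧ (p : ℝ) ≤ w ^ 2) :
    ∑ p ∈ B, (1 : ℝ) / p ≤ 2 + Real.log 4 / Real.log w := by
  have hlw : 0 < Real.log w := Real.log_pos hw
  set N := ⌊w ^ 2⌋₊ with hN
  have hw2 : 1 ≤ w ^ 2 := by nlinarith
  have hN1 : 1 ≤ N := Nat.le_floor (by simpa using hw2)
  have h1 := sum_log_div N hN1
  have h2 : Real.log N ≤ 2 * Real.log w := by
    have : Real.log N ≤ Real.log (w ^ 2) :=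
      Real.log_le_log (by exact_mod_cast hN1) (Nat.floor_le (by positivity))
    rwa [Real.log_pow] at this
  have h3 : ∑ p ∈ B, Real.log p / p ≤ ∑ p ∈ Nat.primesLE N, Real.log p / p := by
    apply Finset.sum_le_sum_of_subset_of_nonneg
    · intro p hp
      have := hB p hp
      exact Nat.mem_primesLE.2 ⟨Nat.le_floor this.2.2, this.1⟩
    · intro p hp _
      have := (Nat.mem_primesLE.1 hp).2.one_lt.le
      exact div_nonneg (Real.log_nonneg (by exact_mod_cast this)) (by positivity)
  have h4 : Real.log w * ∑ p ∈ B, (1 : ℝ) / p ≤ ∑ p ∈ B, Real.log p / p := by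
    rw [Finset.mul_sum]
    apply Finset.sum_le_sum
    intro p hp
    have := hB p hp
    have hp0 : (0 : ℝ) < p := by linarith
    rw [mul_one_div]
    have : Real.log w ≤ Real.log p := Real.log_le_log (by linarith) this.2.1.le
    gcongr
  have h5 : Real.log w * ∑ p ∈ B, (1 : ℝ) / p ≤ Real.log w * (2 + Real.log 4 / Real.log w) := by
    rw [mul_add, mul_div_cancel₀ _ hlw.ne']
    linarith
  exact le_of_mul_le_mul_left h5 hlw

lemma block_est (g : ℕ) (hg : 1 ≤ g) (w : ℝ) (hw4 : 4 ^ 100 ≤ w) (hwg : 100 * g ≤ w) (B : Finset ℕ)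
    (hB : ∀ p ∈ B, p.Prime ∧ w < p ∧ (p : ℝ) ≤ w ^ 2) (δ : ℕ → ℝ) (hδ : ∀ p ∈ B, 0 ≤ δ p)
    (hδg : ∀ p ∈ B, δ p ≤ g / p) :
    ∑ p ∈ B, δ p ≤ 2.01 * g ∧ (1 / 8) ^ g ≤ vProd B δ := by
  have hw1 : 1 < w := lt_of_lt_of_le (by norm_num) hw4
  have hg0 : (0 : ℝ) < g := by exact_mod_cast hg
  have h1 := sum_inv_block w hw1 B hB
  have h2 : Real.log 4 / Real.log w ≤ 0.01 := by
    have h3 : Real.log ((4 : ℝ) ^ 100) ≤ Real.log w := Real.log_le_log (by norm_num) hw4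
    rw [Real.log_pow] at h3
    rw [div_le_iff₀ (Real.log_pos hw1)]
    push_cast at h3
    linarith
  have hS : ∑ p ∈ B, δ p ≤ 2.01 * g := by
    calc ∑ p ∈ B, δ p ≤ ∑ p ∈ B, g * ((1 : ℝ) / p) :=
          Finset.sum_le_sum fun p hp => by rw [mul_one_div]; exact hδg p hp
      _ = g * ∑ p ∈ B, (1 : ℝ) / p := by rw [Finset.mul_sum]
      _ ≤ g * 2.01 := by gcongr; linarith
      _ = _ := by ring
  refine ⟨hS, ?_⟩
  have h5 : ∀ p ∈ B, Real.exp (-(1.02 * δ p)) ≤ 1 - δ p := by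
    intro p hp
    have hpp := hB p hp
    have hp0 : (0 : ℝ) < p := by linarith
    have hsmall : δ p ≤ 1 / 100 := by
      refine (hδg p hp).trans ?_
      rw [div_le_iff₀ hp0]
      linarith
    have h0 := hδ p hp
    rw [← Real.le_log_iff_exp_le (by linarith)]
    have h6 := Real.one_sub_inv_le_log_of_pos (x := 1 - δ p) (by linarith)
    refine le_trans ?_ h6
    have h7 : (1 - δ p)⁻¹ ≤ 1 + 1.02 * δ p := by
      rw [inv_le_comm₀ (by linarith) (by linarith), inv_le_iff_one_le_mul₀ (by linarith)]
      nlinarith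
    linarith
  have h6 : Real.exp (-(1.02 * ∑ p ∈ B, δ p)) ≤ vProd B δ := by
    rw [Finset.mul_sum, ← Finset.sum_neg_distrib, Real.exp_sum]
    exact Finset.prod_le_prod (fun _ _ => (Real.exp_pos _).le) h5
  refine le_trans ?_ h6
  have h7 : Real.log 8 = 3 * Real.log 2 := by
    rw [show (8 : ℝ) = 2 ^ 3 by norm_num, Real.log_pow]; norm_num
  have h8 : ((1 : ℝ) / 8) ^ g = Real.exp (-(g * Real.log 8)) := by
    rw [Real.exp_neg, mul_comm, Real.exp_mul, Real.exp_log (by norm_num), Real.rpow_natCast]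
    simp
  rw [h8]
  apply Real.exp_le_exp.2
  have := Real.log_two_gt_d9
  rw [h7]
  nlinarith

lemma layer_est (g : ℕ) (hg : 1 ≤ g) (B : Finset ℕ) (δ : ℕ → ℝ) (hδ : ∀ p ∈ B, 0 ≤ δ p)
    (hS : ∑ p ∈ B, δ p ≤ 2.01 * g) (i : ℕ) :
    wSum B (layer (10 * g - 1 + 2 * i)) δ ≤ (0.096 * 0.4 ^ i) * (1 / 8) ^ g := by
  set m := 10 * g - 1 + 2 * i with hm
  have hg0 : (0 : ℝ) < g := by exact_mod_cast hg
  have hm9 : (9 * g : ℝ) ≤ m := by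
    have : 9 * g ≤ m := by omega
    exact_mod_cast this
  have hm0 : (0 : ℝ) < m := by linarith
  set s := ∑ p ∈ B, δ p
  have hs0 : 0 ≤ s := Finset.sum_nonneg hδ
  have h1 := layer_le B δ hδ m
  have h2 : s ^ m / (m.factorial : ℝ) ≤ 0.61 ^ m := by
    have e1 := Real.pow_div_factorial_le_exp (m : ℝ) hm0.le m
    have e2 : Real.exp (m : ℝ) = Real.exp 1 ^ m := by rw [← Real.exp_nat_mul, mul_one]
    have e3 : s ^ m / (m.factorial : ℝ) = (s / m) ^ m * ((m : ℝ) ^ m / m.factorial) := by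
      rw [div_pow]; field_simp
    rw [e3]
    calc (s / m) ^ m * ((m : ℝ) ^ m / m.factorial) ≤ (s / m) ^ m * Real.exp 1 ^ m := by
          rw [← e2]; gcongr
      _ = (s / m * Real.exp 1) ^ m := by rw [mul_pow]
      _ ≤ 0.61 ^ m := by
        apply pow_le_pow_left₀ (by positivity)
        have h3 : s / m ≤ 2.01 / 9 := by
          rw [div_le_iff₀ hm0]; linarith
        have h4 := Real.exp_one_lt_d9
        have h5 : 0 < Real.exp 1 := Real.exp_pos 1
        calc s / m * Real.exp 1 ≤ 2.01 / 9 * 2.7182818286 := by gcongr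
          _ ≤ 0.61 := by norm_num
  refine (h1.trans h2).trans ?_
  have e4 : (0.61 : ℝ) ^ m = (0.61 ^ 10) ^ (g - 1) * 0.61 ^ 9 * (0.61 ^ 2) ^ i := by
    rw [← pow_mul, ← pow_mul, ← pow_add, ← pow_add]
    congr 1; omega
  have e5 : ((1 : ℝ) / 8) ^ g = (1 / 8) ^ (g - 1) * (1 / 8) := by
    rw [← pow_succ]; congr 1; omega
  rw [e4, e5]
  have h3 : ((0.61 : ℝ) ^ 10) ^ (g - 1) ≤ (1 / 8) ^ (g - 1) :=
    pow_le_pow_left₀ (by positivity) (by norm_num) _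
  have h4 : ((0.61 : ℝ) ^ 2) ^ i ≤ 0.4 ^ i := pow_le_pow_left₀ (by positivity) (by norm_num) _
  calc ((0.61 : ℝ) ^ 10) ^ (g - 1) * 0.61 ^ 9 * (0.61 ^ 2) ^ i
      ≤ (1 / 8) ^ (g - 1) * (0.096 * (1 / 8)) * 0.4 ^ i := by
        gcongr; norm_num
    _ = _ := by ring

lemma SieveState.mono {P : Finset ℕ} {δ : ℕ → ℝ} (hδ : ∀ p ∈ P, 0 ≤ δ p ∧ δ p ≤ 1)
    {Lev Lev' u u' f f' : ℝ} (h1 : Lev ≤ Lev') (h2 : u ≤ u') (h3 : f' ≤ f)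
    (hs : SieveState P δ Lev u f) : SieveState P δ Lev' u' f' := by
  obtain ⟨cU, cF, a1, a2, a3, a4, a5, a6, a7⟩ := hs
  have hv := (vProd_mem P δ hδ).1
  exact ⟨cU, cF, a1, a2, fun S hS h => (a3 S hS h).trans h1, fun S hS h => (a4 S hS h).trans h1, a5,
    a6.trans (mul_le_mul_of_nonneg_right h2 hv), (mul_le_mul_of_nonneg_right h3 hv).trans a7⟩

lemma vProd_small (P : Finset ℕ) (δ : ℕ → ℝ) (hP : ∀ p ∈ P, p.Prime)
    (hδ : ∀ p ∈ P, δ p ≤ 1 - 1 / p) : (∏ p ∈ P, (p : ℝ))⁻¹ ≤ vProd P δ := by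
  rw [← Finset.prod_inv_distrib]
  apply Finset.prod_le_prod
  · intro p _; positivity
  · intro p hp
    have := hδ p hp
    rw [one_div] at this
    linarith

lemma sieve_build (g : ℕ) (hg : 1 ≤ g) (z : ℝ) (hz : 1 ≤ z) (t : ℕ)
    (hw4 : 4 ^ 100 ≤ z ^ ((1 / 2 : ℝ) ^ t)) (hwg : 100 * g ≤ z ^ ((1 / 2 : ℝ) ^ t))
    (P : Finset ℕ) (hP : ∀ p ∈ P, p.Prime ∧ (p : ℝ) ≤ z) (δ : ℕ → ℝ)
    (hδ : ∀ p ∈ P, 0 ≤ δ p) (hδg : ∀ p ∈ P, δ p ≤ g / p) (hδp : ∀ p ∈ P, δ p ≤ 1 - 1 / p) :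
    SieveState P δ ((∏ p ∈ P.filter (fun p : ℕ => (p : ℝ) ≤ z ^ ((1 / 2 : ℝ) ^ t)), (p : ℝ)) *
      z ^ (20 * g + 2 : ℝ)) 2 (1 / 2) ∧
    (∏ p ∈ P.filter (fun p : ℕ => (p : ℝ) ≤ z ^ ((1 / 2 : ℝ) ^ t)), (p : ℝ))⁻¹ * (1 / 8) ^ (g * t)
      ≤ vProd P δ := by
  set Z : ℕ → ℝ := fun i => z ^ ((1 / 2 : ℝ) ^ i) with hZ
  have hz0 : 0 < z := by linarith
  have hZsq : ∀ i, Z (i + 1) ^ 2 = Z i := by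
    intro i
    simp only [hZ]
    rw [← Real.rpow_natCast, ← Real.rpow_mul hz0.le, pow_succ]
    congr 1; push_cast; ring
  have hZanti : ∀ i j, i ≤ j → Z j ≤ Z i := by
    intro i j hij
    exact Real.rpow_le_rpow_of_exponent_le hz
      (pow_le_pow_of_le_one (by norm_num) (by norm_num) hij)
  have hZ1 : ∀ i, 1 ≤ Z i := fun i => Real.one_le_rpow hz (by positivity)
  have hδ01 : ∀ p ∈ P, 0 ≤ δ p ∧ δ p ≤ 1 := by
    intro p hp
    refine ⟨hδ p hp, (hδp p hp).trans ?_⟩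
    have : (0 : ℝ) ≤ 1 / p := by positivity
    linarith
  change SieveState P δ ((∏ p ∈ P.filter (fun p : ℕ => (p : ℝ) ≤ Z t), (p : ℝ)) * _) _ _ ∧ _
  set W := ∏ p ∈ P.filter (fun p : ℕ => (p : ℝ) ≤ Z t), (p : ℝ) with hW
  have hW0 : 0 ≤ W := Finset.prod_nonneg fun _ _ => by positivity
  have hWi : 0 ≤ W⁻¹ := inv_nonneg.2 hW0
  have main : ∀ i, i ≤ t →
      SieveState (P.filter fun p : ℕ => (p : ℝ) ≤ Z t ∨ Z i < p) δ
        (W * z ^ ((20 * g + 2 : ℝ) - (20 * g + 2 + 4 * i) * (1 / 2) ^ i))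
        (1 + 2 * (0.16 * (1 - 0.4 ^ i))) (1 - 2 * (0.16 * (1 - 0.4 ^ i))) ∧
      W⁻¹ * (1 / 8) ^ (g * i) ≤ vProd (P.filter fun p : ℕ => (p : ℝ) ≤ Z t ∨ Z i < p) δ := by
    intro i
    induction i with
    | zero =>
      intro _
      have e : (P.filter fun p : ℕ => (p : ℝ) ≤ Z t ∨ Z 0 < p) =
          P.filter fun p : ℕ => (p : ℝ) ≤ Z t := by
        apply Finset.filter_congr
        intro p hp
        have h1 : Z 0 = z := by simp [hZ]
        rw [h1]
        have := (hP p hp).2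
        constructor
        · rintro (h | h)
          · exact h
          · linarith
        · exact Or.inl
      rw [e]
      have hsub : ∀ p ∈ P.filter (fun p : ℕ => (p : ℝ) ≤ Z t), p ∈ P :=
        fun p hp => (Finset.mem_filter.1 hp).1
      constructor
      · have := SieveState.base (P.filter fun p : ℕ => (p : ℝ) ≤ Z t) δ
          (fun p hp => (hP p (hsub p hp)).1.one_lt.le)
        simpa using this
      · simp only [mul_zero, pow_zero, mul_one]
        exact vProd_small _ δ (fun p hp => (hP p (hsub p hp)).1) (fun p hp => hδp p (hsub p hp))
    | succ i ih =>
      intro hi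
      obtain ⟨ih1, ih2⟩ := ih (by omega)
      set B := P.filter fun p : ℕ => Z (i + 1) < p ∧ (p : ℝ) ≤ Z i ∧ ¬ (p : ℝ) ≤ Z t with hB
      set P' := P.filter fun p : ℕ => (p : ℝ) ≤ Z t ∨ Z i < p with hP'
      have hun : (P.filter fun p : ℕ => (p : ℝ) ≤ Z t ∨ Z (i + 1) < p) = P' ∪ B := by
        rw [hP', hB, ← Finset.filter_or]
        apply Finset.filter_congr
        intro p _
        have := hZanti i (i + 1) (by omega)
        constructor
        · rintro (h | h)
          · exact Or.inl (Or.inl h)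
          · by_cases h1 : Z i < p
            · exact Or.inl (Or.inr h1)
            · by_cases h2 : (p : ℝ) ≤ Z t
              · exact Or.inl (Or.inl h2)
              · exact Or.inr ⟨h, not_lt.1 h1, h2⟩
        · rintro ((h | h) | h)
          · exact Or.inl h
          · exact Or.inr (by linarith)
          · exact Or.inr h.1
      have hdisj : Disjoint P' B := by
        rw [Finset.disjoint_left]
        intro p h1 h2
        have h1' := (Finset.mem_filter.1 h1).2
        have h2' := (Finset.mem_filter.1 h2).2
        rcases h1' with h | h
        · exact h2'.2.2 h
        · linarith [h2'.2.1]
      have hBsub : ∀ p ∈ B, p ∈ P := fun p hp => (Finset.mem_filter.1 hp).1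
      have hPsub : ∀ p ∈ P' ∪ B, p ∈ P := by
        intro p hp
        rcases Finset.mem_union.1 hp with h | h
        · exact (Finset.mem_filter.1 h).1
        · exact hBsub p h
      have hBp : ∀ p ∈ B, p.Prime ∧ Z (i + 1) < p ∧ (p : ℝ) ≤ Z (i + 1) ^ 2 := by
        intro p hp
        have h2' := (Finset.mem_filter.1 hp).2
        rw [hZsq]
        exact ⟨(hP p (hBsub p hp)).1, h2'.1, h2'.2.1⟩
      have hwi := hZanti (i + 1) t hi
      obtain ⟨hS, hV⟩ := block_est g hg (Z (i + 1)) (hw4.trans hwi) (hwg.trans hwi) B hBp δ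
        (fun p hp => hδ p (hBsub p hp)) (fun p hp => hδg p (hBsub p hp))
      have hl := layer_est g hg B δ (fun p hp => hδ p (hBsub p hp)) hS i
      have h4 : (0 : ℝ) < 0.4 ^ i := by positivity
      have h41 : (0.4 : ℝ) ^ i ≤ 1 := pow_le_one₀ (by norm_num) (by norm_num)
      rw [hun]
      constructor
      · have hst := SieveState.step P' B hdisj δ (fun p hp => hδ01 p (hPsub p hp)) _ _ _
          (by positivity) (by nlinarith) (by nlinarith) (10 * g - 1 + 2 * i)
          (by rw [Nat.odd_iff]; omega) (0.096 * 0.4 ^ i)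
          (hl.trans (mul_le_mul_of_nonneg_left hV (by positivity))) (Z i) (hZ1 i)
          (fun p hp => (hZsq i ▸ (hBp p hp).2.2 : (p : ℝ) ≤ Z i)) ih1
        refine SieveState.mono (fun p hp => hδ01 p (hPsub p hp)) ?_ ?_ ?_ hst
        · rw [mul_assoc]
          apply mul_le_mul_of_nonneg_left _ hW0
          apply le_of_eq
          simp only [hZ]
          rw [← Real.rpow_natCast (z ^ ((1 / 2 : ℝ) ^ i)), ← Real.rpow_mul hz0.le,
            ← Real.rpow_add hz0]
          congr 1
          have : ((10 * g - 1 + 2 * i : ℕ) : ℝ) = 10 * g - 1 + 2 * i := by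
            rw [Nat.cast_add, Nat.cast_sub (by omega)]; push_cast; ring
          rw [this, pow_succ]
          push_cast
          ring
        · rw [pow_succ]; nlinarith
        · rw [pow_succ]; nlinarith
      · rw [vProd_union P' B hdisj]
        have e : W⁻¹ * (1 / 8 : ℝ) ^ (g * (i + 1)) = (W⁻¹ * (1 / 8) ^ (g * i)) * (1 / 8) ^ g := by
          rw [mul_add, mul_one, pow_add]; ring
        rw [e]
        exact mul_le_mul ih2 hV (by positivity) ((by positivity : (0 : ℝ) ≤ _).trans ih2)
  obtain ⟨m1, m2⟩ := main t le_rfl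
  have e : (P.filter fun p : ℕ => (p : ℝ) ≤ Z t ∨ Z t < p) = P := by
    apply Finset.filter_true_of_mem
    intro p _
    exact le_or_gt _ _
  rw [e] at m1 m2
  refine ⟨SieveState.mono hδ01 ?_ ?_ ?_ m1, m2⟩
  · apply mul_le_mul_of_nonneg_left _ hW0
    apply Real.rpow_le_rpow_of_exponent_le hz
    have : (0 : ℝ) ≤ (20 * g + 2 + 4 * t) * (1 / 2) ^ t := by positivity
    linarith
  · have : (0 : ℝ) < 0.4 ^ t := by positivity
    linarith
  · have : (0 : ℝ) < 0.4 ^ t := by positivity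
    linarith

lemma rho_le_deg (Q : Polynomial ℤ) (p : ℕ) (hp : p.Prime) (h : rho Q p < p) :
    rho Q p ≤ Q.natDegree := by
  haveI : Fact p.Prime := ⟨hp⟩
  set R := Q.map (Int.castRingHom (ZMod p)) with hR
  have hev : ∀ n : ℕ, (p : ℤ) ∣ Q.eval (n : ℤ) ↔ R.eval (n : ZMod p) = 0 := by
    intro n
    rw [← ZMod.intCast_zmod_eq_zero_iff_dvd, hR]
    have : (n : ZMod p) = (Int.castRingHom (ZMod p)) (n : ℤ) := by simp
    rw [this, Polynomial.eval_map, Polynomial.eval₂_at_apply]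
    simp
  have hR0 : R ≠ 0 := by
    intro h0
    rw [rho_eq] at h
    have : rootsMod Q p = Finset.range p := by
      apply Finset.filter_true_of_mem
      intro n _
      rw [hev, h0]; simp
    rw [this] at h
    simp at h
  rw [rho_eq]
  calc (rootsMod Q p).card ≤ R.roots.toFinset.card := by
        apply Finset.card_le_card_of_injOn (fun n : ℕ => (n : ZMod p))
        · intro n hn
          have hn' := (mem_rootsMod Q p n).1 hn
          simp only [Finset.mem_coe, Multiset.mem_toFinset, Polynomial.mem_roots hR0]
          exact (hev n).1 hn'.2
        · intro a ha b hb hab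
          have ha' := (mem_rootsMod Q p a).1 ha
          have hb' := (mem_rootsMod Q p b).1 hb
          exact Nat.ModEq.eq_of_lt_of_lt ((ZMod.natCast_eq_natCast_iff a b p).1 hab) ha'.1 hb'.1
    _ ≤ R.roots.card := Multiset.toFinset_card_le _
    _ ≤ R.natDegree := Polynomial.card_roots' R
    _ ≤ Q.natDegree := Polynomial.natDegree_map_le

lemma prod_small_le (P : Finset ℕ) (hP : ∀ p ∈ P, p.Prime) (v : ℝ) (hv : ∀ p ∈ P, (p : ℝ) ≤ v) :
    ∏ p ∈ P, (p : ℝ) ≤ 4 ^ ⌊v⌋₊ := by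
  have h1 : ∏ p ∈ P, p ≤ primorial ⌊v⌋₊ := by
    rw [primorial_eq_prod_primesLE]
    apply Finset.prod_le_prod_of_subset_of_one_le'
    · intro p hp
      have := Nat.le_floor (hv p hp)
      exact Nat.mem_primesLE.2 ⟨this, hP p hp⟩
    · intro p hp _
      exact (Nat.mem_primesLE.1 hp).2.one_lt.le
  have h2 := h1.trans (primorial_le_four_pow _)
  have h3 : ((∏ p ∈ P, p : ℕ) : ℝ) ≤ ((4 ^ ⌊v⌋₊ : ℕ) : ℝ) := Nat.cast_le.2 h2
  push_cast at h3
  exact h3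

theorem sieve_lower (g : ℕ) (hg : 1 ≤ g) : ∃ z₀ : ℝ, 2 ≤ z₀ ∧ ∀ (Q : Polynomial ℤ),
    Q.natDegree ≤ g → (∀ p : ℕ, p.Prime → rho Q p < p) → ∀ z : ℝ, z₀ ≤ z →
    ∀ P : Finset ℕ, (∀ p ∈ P, p.Prime ∧ (p : ℝ) ≤ z) → ∀ q : ℕ, 1 ≤ q →
    (∀ p ∈ P, Nat.Coprime q p) → ∀ (b : ℤ) (x y : ℝ), 0 ≤ y → z ^ (48 * g) ≤ y / q →
    1 / 4 * (y / q) * vProd P (fun p => (rho Q p : ℝ) / p) ≤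
      (((intI x y).filter fun n => n ≡ b [ZMOD q] ∧ ∀ p ∈ P, ¬ (p : ℤ) ∣ Q.eval n).card : ℝ) := by
  set w₀ : ℝ := 4 ^ 100 + 100 * g with hw₀
  have hg0 : (1 : ℝ) ≤ g := by exact_mod_cast hg
  have hw4 : (4 : ℝ) ^ 100 ≤ w₀ := by rw [hw₀]; linarith
  have hwg : (100 * g : ℝ) ≤ w₀ := by rw [hw₀]; linarith [show (0 : ℝ) ≤ 4 ^ 100 by positivity]
  have hw0e : Real.exp 1 ≤ w₀ := by
    have := Real.exp_one_lt_d9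
    have h4 : (100 : ℝ) ≤ w₀ := by linarith
    linarith
  have hw01 : 1 < w₀ := by linarith [Real.add_one_lt_exp (one_ne_zero : (1 : ℝ) ≠ 0)]
  have hlw : 1 ≤ Real.log w₀ := (Real.le_log_iff_exp_le (by linarith)).2 hw0e
  set C : ℝ := 4 ^ ⌊w₀ ^ 2⌋₊ with hC
  have hC1 : 1 ≤ C := one_le_pow₀ (by norm_num)
  refine ⟨w₀ ^ 2 + 24 * C, by nlinarith, ?_⟩
  intro Q hdeg hfix z hz P hP q hq hcop b x y hy hyq
  have hzw : w₀ ^ 2 ≤ z := by linarith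
  have hzC : 24 * C ≤ z := by nlinarith
  have hz1 : 1 ≤ z := by linarith
  have hz0 : 0 < z := by linarith
  -- choice of `t`
  have hex : ∃ t : ℕ, z ^ ((1 / 2 : ℝ) ^ t) < w₀ ^ 2 := by
    have hlz : 0 < Real.log z + 1 := by have := Real.log_nonneg hz1; linarith
    obtain ⟨t, ht⟩ := exists_pow_lt_of_lt_one (x := 1 / (Real.log z + 1)) (y := (1 / 2 : ℝ))
      (by positivity) (by norm_num)
    refine ⟨t, ?_⟩
    rw [lt_div_iff₀ hlz] at ht
    have hp : (0 : ℝ) < (1 / 2) ^ t := by positivity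
    rw [Real.rpow_def_of_pos hz0, ← Real.lt_log_iff_exp_lt (by positivity), Real.log_pow]
    push_cast
    nlinarith
  set t := Nat.find hex with ht
  have ht1 : z ^ ((1 / 2 : ℝ) ^ t) < w₀ ^ 2 := Nat.find_spec hex
  have htpos : t ≠ 0 := by
    intro h0
    rw [h0] at ht1
    simp at ht1
    linarith
  obtain ⟨s, hs⟩ := Nat.exists_eq_succ_of_ne_zero htpos
  have hs1 : w₀ ^ 2 ≤ z ^ ((1 / 2 : ℝ) ^ s) := by
    have := Nat.find_min hex (m := s) (by omega)
    exact not_lt.1 this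
  have hZt : w₀ ≤ z ^ ((1 / 2 : ℝ) ^ t) := by
    have e : (z ^ ((1 / 2 : ℝ) ^ t)) ^ 2 = z ^ ((1 / 2 : ℝ) ^ s) := by
      rw [← Real.rpow_natCast, ← Real.rpow_mul hz0.le, hs, pow_succ]
      congr 1; push_cast; ring
    rw [← e] at hs1
    exact le_of_sq_le_sq hs1 (by positivity)
  have h2t : (2 : ℝ) ^ t ≤ Real.log z := by
    have h1 := Real.log_le_log (by linarith) hZt
    rw [Real.log_rpow hz0] at h1
    have h2 : (1 : ℝ) ≤ (1 / 2) ^ t * Real.log z := hlw.trans h1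
    rw [one_div, inv_pow, inv_mul_eq_div, le_div_iff₀ (by positivity)] at h2
    linarith
  set δ : ℕ → ℝ := fun p => (rho Q p : ℝ) / p with hδ
  have hδ0 : ∀ p ∈ P, 0 ≤ δ p := fun p _ => by positivity
  have hδg : ∀ p ∈ P, δ p ≤ g / p := by
    intro p hp
    have h1 : rho Q p ≤ g := (rho_le_deg Q p (hP p hp).1 (hfix p (hP p hp).1)).trans hdeg
    have h2 : (rho Q p : ℝ) ≤ g := by exact_mod_cast h1
    simp only [hδ]
    gcongr
  have hδp : ∀ p ∈ P, δ p ≤ 1 - 1 / p := by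
    intro p hp
    have h1 : rho Q p + 1 ≤ p := hfix p (hP p hp).1
    have h2 : (rho Q p : ℝ) + 1 ≤ p := by exact_mod_cast h1
    have hp0 : (0 : ℝ) < p := by exact_mod_cast (hP p hp).1.pos
    simp only [hδ]
    rw [le_sub_iff_add_le, ← add_div, div_le_one hp0]
    exact h2
  obtain ⟨hst, hV⟩ := sieve_build g hg z hz1 t (hw4.trans hZt) (hwg.trans hZt) P hP δ hδ0 hδg hδp
  set W := ∏ p ∈ P.filter (fun p : ℕ => (p : ℝ) ≤ z ^ ((1 / 2 : ℝ) ^ t)), (p : ℝ) with hW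
  have hWC : W ≤ C := by
    apply prod_small_le
    · intro p hp; exact (hP p (Finset.mem_filter.1 hp).1).1
    · intro p hp; exact (Finset.mem_filter.1 hp).2.trans ht1.le
  have hW0 : 0 < W := Finset.prod_pos fun p hp => by
    exact_mod_cast (hP p (Finset.mem_filter.1 hp).1).1.pos
  have hmain := sieve_count Q x y hy P (fun p hp => (hP p hp).1) q hq hcop b _ _ _
    (by positivity) hst
  have hLev : (W * z ^ (20 * g + 2 : ℝ)) ^ 2 ≤ z ^ (46 * g) := by
    have e : z ^ (20 * g + 2 : ℝ) = z ^ (20 * g + 2) := by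
      rw [← Real.rpow_natCast]; push_cast; rfl
    rw [e]
    have h1 : W * z ^ (20 * g + 2) ≤ z ^ (23 * g) := by
      calc W * z ^ (20 * g + 2) ≤ z * z ^ (20 * g + 2) := by
            gcongr; linarith
        _ = z ^ (20 * g + 3) := by ring
        _ ≤ z ^ (23 * g) := pow_le_pow_right₀ hz1 (by omega)
    calc (W * z ^ (20 * g + 2)) ^ 2 ≤ (z ^ (23 * g)) ^ 2 := by gcongr
      _ = z ^ (46 * g) := by rw [← pow_mul]; congr 1; ring
  have hlog3 : (Real.log z) ^ 3 ≤ 6 * z := by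
    have h1 := Real.pow_div_factorial_le_exp (Real.log z) (Real.log_nonneg hz1) 3
    rw [Real.exp_log hz0, div_le_iff₀ (by positivity)] at h1
    have : ((Nat.factorial 3 : ℕ) : ℝ) = 6 := by norm_num [Nat.factorial]
    rw [this] at h1
    linarith
  have h8 : ((6 * z) ^ g)⁻¹ ≤ (1 / 8 : ℝ) ^ (g * t) := by
    have e : (1 / 8 : ℝ) ^ (g * t) = (((2 ^ t) ^ 3) ^ g)⁻¹ := by
      rw [one_div, inv_pow, ← pow_mul, ← pow_mul, show (8 : ℝ) = 2 ^ 3 by norm_num, ← pow_mul]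
      congr 2; ring
    rw [e]
    apply inv_anti₀ (by positivity)
    apply pow_le_pow_left₀ (by positivity)
    refine le_trans ?_ hlog3
    gcongr
  have hVlow : (C * (6 * z) ^ g)⁻¹ ≤ vProd P δ := by
    refine le_trans ?_ hV
    rw [mul_inv]
    apply mul_le_mul (inv_anti₀ hW0 hWC) h8 (by positivity) (by positivity)
  have hfin : z ^ (46 * g) ≤ 1 / 4 * (y / q) * vProd P δ := by
    calc z ^ (46 * g) ≤ 1 / 4 * z ^ (48 * g) * (C * (6 * z) ^ g)⁻¹ := by
          rw [← div_eq_mul_inv, le_div_iff₀ (by positivity)]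
          have h1 : 4 * C * 6 ^ g ≤ z ^ g := by
            calc 4 * C * 6 ^ g ≤ (4 * C) ^ g * 6 ^ g := by
                  gcongr
                  exact le_self_pow₀ (by linarith) (by omega)
              _ = (24 * C) ^ g := by rw [← mul_pow]; congr 1; ring
              _ ≤ z ^ g := by gcongr
          have e : z ^ (48 * g) = z ^ (46 * g) * z ^ g * z ^ g := by
            rw [← pow_add, ← pow_add]; congr 1; ring
          rw [e, mul_pow]
          have h2 : 0 ≤ z ^ (46 * g) * z ^ g := by positivity
          nlinarith
      _ ≤ _ := by gcongr
  have : y / q * (1 / 2 * vProd P δ) = 1 / 4 * (y / q) * vProd P δ + 1 / 4 * (y / q) * vProd P δ := by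
    ring
  rw [this] at hmain
  linarith

lemma one_sub_ge_exp (g p ρ : ℕ) (hg : 1 ≤ g) (hp : p.Prime) (h1 : ρ < p) (h2 : ρ ≤ g) :
    Real.exp (-((ρ : ℝ) / p) - 8 * (g : ℝ) ^ 3 * (1 / (p : ℝ) ^ 2)) ≤ 1 - (ρ : ℝ) / p := by
  have hp0 : (0 : ℝ) < p := by exact_mod_cast hp.pos
  have hg0 : (1 : ℝ) ≤ g := by exact_mod_cast hg
  have hρ : (ρ : ℝ) + 1 ≤ p := by exact_mod_cast h1
  have hρg : (ρ : ℝ) ≤ g := by exact_mod_cast h2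
  have hρ0 : (0 : ℝ) ≤ ρ := by positivity
  have hu0 : 0 ≤ (ρ : ℝ) / p := by positivity
  by_cases hc : (p : ℝ) ≤ 2 * g
  · have h3 : 1 / (p : ℝ) ≤ 1 - (ρ : ℝ) / p := by
      rw [div_le_iff₀ hp0, sub_mul, div_mul_cancel₀ _ hp0.ne']; linarith
    refine le_trans ?_ h3
    have h4 : (p : ℝ) ≤ 8 * (g : ℝ) ^ 3 * (1 / (p : ℝ) ^ 2) := by
      rw [mul_one_div, le_div_iff₀ (by positivity)]
      calc (p : ℝ) * (p : ℝ) ^ 2 = (p : ℝ) ^ 3 := by ring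
        _ ≤ (2 * (g : ℝ)) ^ 3 := pow_le_pow_left₀ hp0.le hc 3
        _ = _ := by ring
    calc _ ≤ Real.exp (-p) := Real.exp_le_exp.2 (by linarith)
      _ ≤ 1 / p := by
        rw [Real.exp_neg, ← one_div]
        exact one_div_le_one_div_of_le hp0 (by linarith [Real.add_one_le_exp (p : ℝ)])
  · push Not at hc
    set u := (ρ : ℝ) / p with hu
    have hu2 : u ≤ 1 / 2 := by
      rw [hu, div_le_iff₀ hp0]; linarith
    have h3 : 1 - (1 - u)⁻¹ ≤ Real.log (1 - u) := Real.one_sub_inv_le_log_of_pos (by linarith)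
    have h4 : -u - 2 * u ^ 2 ≤ 1 - (1 - u)⁻¹ := by
      have : (1 - u)⁻¹ ≤ 1 + u + 2 * u ^ 2 := by
        rw [inv_le_iff_one_le_mul₀ (by linarith)]
        nlinarith [mul_nonneg (sq_nonneg u) (by linarith : 0 ≤ 1 - 2 * u)]
      linarith
    have h5 : 2 * u ^ 2 ≤ 8 * (g : ℝ) ^ 3 * (1 / (p : ℝ) ^ 2) := by
      rw [mul_one_div, hu, div_pow, ← mul_div_assoc]
      apply div_le_div_of_nonneg_right _ (by positivity)
      have : (ρ : ℝ) ^ 2 ≤ (g : ℝ) ^ 2 := pow_le_pow_left₀ hρ0 hρg 2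
      nlinarith [sq_nonneg (g : ℝ)]
    rw [← Real.le_log_iff_exp_le (by linarith)]
    linarith

lemma prod_lower (g : ℕ) (hg : 1 ≤ g) : ∃ c : ℝ, 0 < c ∧ ∀ Q : Polynomial ℤ, Q.natDegree ≤ g →
    (∀ p : ℕ, p.Prime → rho Q p < p) → ∀ P : Finset ℕ, (∀ p ∈ P, p.Prime) →
    c * Real.exp (-∑ p ∈ P, (rho Q p : ℝ) / p) ≤ vProd P (fun p => (rho Q p : ℝ) / p) := by
  refine ⟨Real.exp (-(8 * (g : ℝ) ^ 3 * ∑' n : ℕ, 1 / (n : ℝ) ^ 2)), Real.exp_pos _, ?_⟩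
  intro Q hQ hfix P hP
  have hs : Summable (fun n : ℕ => 1 / (n : ℝ) ^ 2) := Real.summable_one_div_nat_pow.2 (by norm_num)
  have h1 : ∑ p ∈ P, 1 / (p : ℝ) ^ 2 ≤ ∑' n : ℕ, 1 / (n : ℝ) ^ 2 :=
    hs.sum_le_tsum P (fun i _ => by positivity)
  calc _ = Real.exp (-(8 * (g : ℝ) ^ 3 * ∑' n : ℕ, 1 / (n : ℝ) ^ 2) + -∑ p ∈ P, (rho Q p : ℝ) / p) :=
        (Real.exp_add _ _).symm
    _ ≤ Real.exp (∑ p ∈ P, (-((rho Q p : ℝ) / p) - 8 * (g : ℝ) ^ 3 * (1 / (p : ℝ) ^ 2))) := by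
        rw [Real.exp_le_exp, Finset.sum_sub_distrib, ← Finset.mul_sum, Finset.sum_neg_distrib]
        have : 8 * (g : ℝ) ^ 3 * ∑ p ∈ P, 1 / (p : ℝ) ^ 2 ≤
          8 * (g : ℝ) ^ 3 * ∑' n : ℕ, 1 / (n : ℝ) ^ 2 := by gcongr
        linarith
    _ = ∏ p ∈ P, Real.exp (-((rho Q p : ℝ) / p) - 8 * (g : ℝ) ^ 3 * (1 / (p : ℝ) ^ 2)) :=
        Real.exp_sum _ _
    _ ≤ _ := by
        unfold vProd
        apply Finset.prod_le_prod
        · intro p _; exact (Real.exp_pos _).le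
        · intro p hp
          exact one_sub_ge_exp g p _ hg (hP p hp) (hfix p (hP p hp))
            ((rho_le_deg Q p (hP p hp) (hfix p (hP p hp))).trans hQ)

lemma eval_prod_fin {r : ℕ} (Qs : Fin r → Polynomial ℤ) (n : ℤ) :
    (∏ j, Qs j).eval n = ∏ j, (Qs j).eval n := by
  rw [Polynomial.eval_prod]

lemma prime_dvd_prod_eval {r : ℕ} (Qs : Fin r → Polynomial ℤ) (n : ℤ) (p : ℕ) (hp : p.Prime) :
    (p : ℤ) ∣ (∏ j, Qs j).eval n ↔ ∃ j, (p : ℤ) ∣ (Qs j).eval n := by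
  rw [eval_prod_fin, Prime.dvd_finsetProd_iff (Nat.prime_iff_prime_int.1 hp)]
  simp

lemma rho_prod_le {r : ℕ} (Qs : Fin r → Polynomial ℤ) (p : ℕ) (hp : p.Prime) :
    rho (∏ j, Qs j) p ≤ ∑ j, rho (Qs j) p := by
  simp only [rho_eq]
  refine le_trans (Finset.card_le_card ?_)
    (Finset.card_biUnion_le (s := Finset.univ) (t := fun j => rootsMod (Qs j) p))
  intro n hn
  rw [mem_rootsMod, prime_dvd_prod_eval _ _ _ hp] at hn
  obtain ⟨h1, j, hj⟩ := hn
  exact Finset.mem_biUnion.2 ⟨j, Finset.mem_univ _, (mem_rootsMod _ _ _).2 ⟨h1, hj⟩⟩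

lemma vProd_antitone (P R : Finset ℕ) (h : P ⊆ R) (δ : ℕ → ℝ) (hδ : ∀ p ∈ R, 0 ≤ δ p ∧ δ p ≤ 1) :
    vProd R δ ≤ vProd P δ := by
  unfold vProd
  rw [← Finset.prod_sdiff h]
  apply mul_le_of_le_one_left
  · exact Finset.prod_nonneg fun p hp => by linarith [(hδ p (h hp)).2]
  · apply Finset.prod_le_one
    · intro p hp; linarith [(hδ p (Finset.mem_sdiff.1 hp).1).2]
    · intro p hp; linarith [(hδ p (Finset.mem_sdiff.1 hp).1).1]

theorem sieve_density (r g : ℕ) (hg : 1 ≤ g) : ∃ c : ℝ, 0 < c ∧ ∀ (Qs : Fin r → Polynomial ℤ)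
    (Mj : Fin r → ℝ), (∏ j, Qs j).natDegree ≤ g →
    (∀ p : ℕ, p.Prime → rho (∏ j, Qs j) p < p) → ∀ z : ℝ, 2 ≤ z →
    (∀ j, (∑ p ∈ primesBelow z, (rho (Qs j) p : ℝ) / p) - Real.log (Real.log z) ≤ Mj j) →
    ∀ P ⊆ primesBelow z,
    c * Real.exp (-∑ j, Mj j) / (Real.log z) ^ r ≤
      vProd P (fun p => (rho (∏ j, Qs j) p : ℝ) / p) := by
  obtain ⟨c, hc, H⟩ := prod_lower g hg
  refine ⟨c, hc, ?_⟩
  intro Qs Mj hdeg hfix z hz hM P hP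
  have hpr : ∀ p ∈ primesBelow z, p.Prime := fun p hp => (Finset.mem_filter.1 hp).2
  have hlog : 0 < Real.log z := Real.log_pos (by linarith)
  refine le_trans ?_ (vProd_antitone P _ hP _ ?_)
  · refine le_trans ?_ (H _ hdeg hfix _ hpr)
    have h1 : ∑ p ∈ primesBelow z, (rho (∏ j, Qs j) p : ℝ) / p ≤
        ∑ j, (Mj j + Real.log (Real.log z)) := by
      calc _ ≤ ∑ p ∈ primesBelow z, ∑ j, (rho (Qs j) p : ℝ) / p := by
            apply Finset.sum_le_sum
            intro p hp
            rw [← Finset.sum_div]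
            apply div_le_div_of_nonneg_right _ (by positivity)
            exact_mod_cast rho_prod_le Qs p (hpr p hp)
        _ = ∑ j, ∑ p ∈ primesBelow z, (rho (Qs j) p : ℝ) / p := Finset.sum_comm
        _ ≤ _ := Finset.sum_le_sum fun j _ => by linarith [hM j]
    rw [Finset.sum_add_distrib] at h1
    simp only [Finset.sum_const, Finset.card_univ, Fintype.card_fin, nsmul_eq_mul] at h1
    have h2 : Real.exp (-∑ j, Mj j) / (Real.log z) ^ r =
        Real.exp (-(∑ j, Mj j + r * Real.log (Real.log z))) := by
      rw [neg_add, Real.exp_add, div_eq_mul_inv, Real.exp_neg (r * _), Real.exp_nat_mul,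
        Real.exp_log hlog]
    rw [mul_div_assoc, h2]
    gcongr
  · intro p hp
    have hp' := hpr p hp
    have : (0 : ℝ) < p := by exact_mod_cast hp'.pos
    refine ⟨by positivity, ?_⟩
    rw [div_le_one this]
    exact_mod_cast rho_le _ _

/-- Residues `b` modulo `a^2` with `Q(b)` divisible by `a` and `Q(b)/a` coprime to `a`. -/
noncomputable def goodCl (Q : Polynomial ℤ) (a : ℕ) : Finset ℕ :=
  (Finset.range (a ^ 2)).filter fun b : ℕ =>
    (a : ℤ) ∣ Q.eval (b : ℤ) ∧ IsCoprime (Q.eval (b : ℤ) / a) (a : ℤ)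

lemma mem_goodCl (Q : Polynomial ℤ) (a b : ℕ) : b ∈ goodCl Q a ↔ b < a ^ 2 ∧
    (a : ℤ) ∣ Q.eval (b : ℤ) ∧ IsCoprime (Q.eval (b : ℤ) / a) (a : ℤ) := by
  simp [goodCl]

lemma isCoprime_of_primes (u : ℤ) (a : ℕ)
    (h : ∀ p : ℕ, p.Prime → p ∣ a → ¬ (p : ℤ) ∣ u) : IsCoprime u (a : ℤ) := by
  rw [Int.isCoprime_iff_gcd_eq_one]
  by_contra hne
  obtain ⟨p, hp, hpd⟩ := Nat.exists_prime_and_dvd hne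
  have h1 : (p : ℤ) ∣ u := (Int.natCast_dvd_natCast.2 hpd).trans (Int.gcd_dvd_left _ _)
  have h2 : (p : ℤ) ∣ (a : ℤ) := (Int.natCast_dvd_natCast.2 hpd).trans (Int.gcd_dvd_right _ _)
  exact h p hp (Int.natCast_dvd_natCast.1 h2) h1

lemma good_card (Q : Polynomial ℤ) (a : ℕ) (ha : 1 ≤ a)
    (hder : ∀ p : ℕ, p.Prime → p ∣ a → ∀ n : ℤ, (p : ℤ) ∣ Q.eval n →
      ¬ (p : ℤ) ∣ (Polynomial.derivative Q).eval n) :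
    rho Q a * a.totient ≤ (goodCl Q a).card := by
  rw [rho_eq, Nat.totient, ← Finset.card_product]
  have ha0 : (0 : ℤ) < a := by exact_mod_cast ha
  apply Finset.card_le_card_of_surjOn (fun b : ℕ => (b % a, (Q.eval (b : ℤ) / a % a).toNat))
  rintro ⟨n0, s⟩ h
  simp only [Finset.coe_product, Set.mem_prod, Finset.mem_coe, Finset.mem_filter,
    Finset.mem_range, mem_rootsMod] at h
  obtain ⟨⟨hn, m, hm⟩, hs, hsc⟩ := h
  have hcop : IsCoprime ((Polynomial.derivative Q).eval (n0 : ℤ)) (a : ℤ) := by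
    apply isCoprime_of_primes
    intro p hp hpa
    apply hder p hp hpa
    exact (Int.natCast_dvd_natCast.2 hpa).trans ⟨m, hm⟩
  set q' := (Polynomial.derivative Q).eval (n0 : ℤ) with hq'
  obtain ⟨e, e', he⟩ := hcop
  set t : ℕ := (((s - m) * e) % a).toNat with ht
  have ht' : (t : ℤ) = ((s - m) * e) % a := by
    rw [ht, Int.toNat_of_nonneg (Int.emod_nonneg _ ha0.ne')]
  have hta : t < a := by
    have := Int.emod_lt_of_pos ((s - m) * e) ha0
    rw [← ht'] at this
    exact_mod_cast this
  obtain ⟨k, hk⟩ := Polynomial.binomExpansion Q (n0 : ℤ) ((a : ℤ) * t)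
  obtain ⟨w, hw⟩ : ∃ w, (t : ℤ) = (s - m) * e + a * w :=
    ⟨-((s - m) * e / a), by rw [ht', Int.emod_def]; ring⟩
  have hval : Q.eval ((n0 + a * t : ℕ) : ℤ) = a * (s + a * (-(s - m) * e' + w * q' + k * t ^ 2)) := by
    push_cast
    rw [hk, hm]
    have e1 : (s - m) * e * q' = (s - m) - (s - m) * e' * a := by linear_combination (s - m : ℤ) * he
    have e2 : q' * (t : ℤ) = (s - m) - (s - m) * e' * a + a * w * q' := by
      rw [hw]; linear_combination e1
    linear_combination (a : ℤ) * e2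
  have hdiv : Q.eval ((n0 + a * t : ℕ) : ℤ) / a = s + a * (-(s - m) * e' + w * q' + k * t ^ 2) := by
    rw [hval, Int.mul_ediv_cancel_left _ ha0.ne']
  refine ⟨n0 + a * t, ?_, ?_⟩
  · rw [Finset.mem_coe, mem_goodCl]
    refine ⟨by nlinarith, ⟨_, hval⟩, ?_⟩
    rw [hdiv, IsCoprime.add_mul_left_left_iff]
    exact (Nat.isCoprime_iff_coprime.2 hsc).symm
  · simp only [Prod.mk.injEq]
    refine ⟨by rw [Nat.add_mul_mod_self_left, Nat.mod_eq_of_lt hn], ?_⟩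
    rw [hdiv, Int.add_mul_emod_self_left, Int.emod_eq_of_lt (by positivity) (by exact_mod_cast hs)]
    simp

lemma crt_fin {r : ℕ} (m : Fin r → ℕ) (hm : ∀ i j, i ≠ j → Nat.Coprime (m i) (m j))
    (b : Fin r → ℤ) : ∃ c : ℤ, ∀ n : ℤ, (∀ j, n ≡ b j [ZMOD m j]) ↔
      n ≡ c [ZMOD ((∏ j, m j : ℕ) : ℤ)] := by
  have key : ∀ s : Finset (Fin r), ∃ c : ℤ, ∀ n : ℤ, (∀ j ∈ s, n ≡ b j [ZMOD m j]) ↔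
      n ≡ c [ZMOD ((∏ j ∈ s, m j : ℕ) : ℤ)] := by
    intro s
    induction s using Finset.induction_on with
    | empty => exact ⟨0, fun n => by simp [Int.modEq_one]⟩
    | insert i s hi ih =>
      obtain ⟨c, hc⟩ := ih
      have hco : Nat.Coprime (m i) (∏ j ∈ s, m j) := by
        apply Nat.Coprime.prod_right
        intro j hj
        exact hm i j (fun h => hi (h ▸ hj))
      obtain ⟨d, hd⟩ := int_crt (m i) _ hco (b i) c
      refine ⟨d, fun n => ?_⟩
      rw [Finset.prod_insert hi, ← hd, ← hc]
      simp
  obtain ⟨c, hc⟩ := key Finset.univ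
  exact ⟨c, fun n => by rw [← hc]; simp⟩

lemma goodCl_congr (Q : Polynomial ℤ) (a b : ℕ) (ha : 1 ≤ a) (hb : b ∈ goodCl Q a) (n : ℤ)
    (h : n ≡ (b : ℤ) [ZMOD ((a ^ 2 : ℕ) : ℤ)]) :
    ∃ m : ℤ, Q.eval n = a * m ∧ IsCoprime m (a : ℤ) := by
  have ha0 : (0 : ℤ) < a := by exact_mod_cast ha
  obtain ⟨_, ⟨m0, hm0⟩, hc⟩ := (mem_goodCl Q a b).1 hb
  have h1 : ((a ^ 2 : ℕ) : ℤ) ∣ Q.eval n - Q.eval (b : ℤ) :=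
    (h.symm.dvd).trans (Polynomial.sub_dvd_eval_sub n b Q)
  obtain ⟨w, hw⟩ := h1
  rw [hm0, Int.mul_ediv_cancel_left _ ha0.ne'] at hc
  refine ⟨m0 + a * w, ?_, ?_⟩
  · push_cast at hw
    linear_combination hw + hm0
  · rwa [IsCoprime.add_mul_left_left_iff]

lemma abs_coeff_le (Q : Polynomial ℤ) (i : ℕ) : |((Q.coeff i : ℤ) : ℝ)| ≤ polyNorm Q := by
  unfold polyNorm
  by_cases h : i ∈ Q.support
  · have := Finset.le_sup (f := fun i => (Q.coeff i).natAbs) h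
    have h2 : |((Q.coeff i : ℤ) : ℝ)| = (((Q.coeff i).natAbs : ℕ) : ℝ) := by
      rw [Nat.cast_natAbs]; simp
    rw [h2]
    exact Nat.cast_le.2 this
  · rw [Polynomial.notMem_support_iff.1 h]; simp

lemma one_le_polyNorm (Q : Polynomial ℤ) (h : Q ≠ 0) : 1 ≤ polyNorm Q := by
  refine le_trans ?_ (abs_coeff_le Q Q.natDegree)
  have : Q.coeff Q.natDegree ≠ 0 := by simpa using h
  exact_mod_cast Int.one_le_abs this

lemma eval_bound (Q : Polynomial ℤ) (n : ℤ) (X : ℝ) (hX : 1 ≤ X) (hn : |(n : ℝ)| ≤ X) :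
    |((Q.eval n : ℤ) : ℝ)| ≤ (Q.natDegree + 1) * polyNorm Q * X ^ Q.natDegree := by
  rw [Polynomial.eval_eq_sum_range]
  push_cast
  refine (Finset.abs_sum_le_sum_abs _ _).trans ?_
  have h0 : 0 ≤ polyNorm Q := by unfold polyNorm; positivity
  calc _ ≤ ∑ i ∈ Finset.range (Q.natDegree + 1), polyNorm Q * X ^ Q.natDegree := by
        apply Finset.sum_le_sum
        intro i hi
        rw [abs_mul, abs_pow]
        apply mul_le_mul (abs_coeff_le Q i) _ (by positivity) h0
        calc |(n : ℝ)| ^ i ≤ X ^ i := pow_le_pow_left₀ (abs_nonneg _) hn i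
          _ ≤ _ := pow_le_pow_right₀ hX (Nat.lt_succ_iff.1 (Finset.mem_range.1 hi))
    _ = _ := by simp; ring

lemma deg_pos {r : ℕ} (Qs : Fin r → Polynomial ℤ) (hirr : ∀ j, Irreducible (Qs j))
    (hfix : ∀ p : ℕ, p.Prime → rho (∏ j, Qs j) p < p) (j : Fin r) : 1 ≤ (Qs j).natDegree := by
  by_contra h
  have h0 : (Qs j).natDegree = 0 := by omega
  obtain ⟨c, hc⟩ := Polynomial.natDegree_eq_zero.1 h0
  have hcu : c.natAbs ≠ 1 := by
    intro h1
    have : IsUnit c := Int.isUnit_iff_natAbs_eq.2 h1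
    exact (hirr j).not_isUnit (hc ▸ Polynomial.isUnit_C.2 this)
  obtain ⟨p, hp, hpc⟩ := Nat.exists_prime_and_dvd hcu
  have hlt := hfix p hp
  rw [rho_eq] at hlt
  have : rootsMod (∏ j, Qs j) p = Finset.range p := by
    apply Finset.filter_true_of_mem
    intro n _
    rw [prime_dvd_prod_eval _ _ _ hp]
    refine ⟨j, ?_⟩
    rw [← hc, Polynomial.eval_C]
    exact Int.natCast_dvd.2 hpc
  rw [this] at hlt
  simp at hlt

lemma r_le_g {r : ℕ} (Qs : Fin r → Polynomial ℤ) (hirr : ∀ j, Irreducible (Qs j))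
    (hfix : ∀ p : ℕ, p.Prime → rho (∏ j, Qs j) p < p) : r ≤ (∏ j, Qs j).natDegree := by
  rw [Polynomial.natDegree_prod _ _ (fun j _ => (hirr j).ne_zero)]
  calc r = ∑ _j : Fin r, 1 := by simp
    _ ≤ _ := Finset.sum_le_sum fun j _ => deg_pos Qs hirr hfix j

lemma smooth_unique (z : ℝ) (a a' m m' : ℕ) (ha : 1 ≤ a) (ha' : 1 ≤ a') (haz : (a : ℝ) ≤ z)
    (haz' : (a' : ℝ) ≤ z) (hm : ∀ p : ℕ, p.Prime → p ∣ m → z < (p : ℝ))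
    (hm' : ∀ p : ℕ, p.Prime → p ∣ m' → z < (p : ℝ)) (h : a * m = a' * m') : a = a' := by
  have key : ∀ a m : ℕ, 1 ≤ a → (a : ℝ) ≤ z → (∀ p : ℕ, p.Prime → p ∣ m → z < (p : ℝ)) →
      Nat.Coprime a m := by
    intro a m ha haz hm
    apply Nat.Coprime.symm
    apply Nat.coprime_of_dvd
    intro p hp hpm hpa
    have h1 := hm p hp hpm
    have h2 : (p : ℝ) ≤ a := by exact_mod_cast Nat.le_of_dvd ha hpa
    linarith
  apply Nat.dvd_antisymm
  · exact (key a m' ha haz hm').dvd_of_dvd_mul_right (h ▸ Dvd.intro _ rfl)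
  · exact (key a' m ha' haz' hm).dvd_of_dvd_mul_right (h ▸ Dvd.intro _ rfl)

lemma deriv_cond {r : ℕ} (Qs : Fin r → Polynomial ℤ) (D : ℤ)
    (hD : ∀ p : ℕ, p.Prime →
          ((∃ n : ℤ, (p : ℤ) ∣ (∏ j, Qs j).eval n ∧
              (p : ℤ) ∣ (Polynomial.derivative (∏ j, Qs j)).eval n) ∨
           (∃ i j : Fin r, i ≠ j ∧ ∃ n : ℤ,
              (p : ℤ) ∣ (Qs i).eval n ∧ (p : ℤ) ∣ (Qs j).eval n)) →
          (p : ℤ) ∣ D) (j : Fin r) (p : ℕ) (hp : p.Prime) (hpD : ¬ (p : ℤ) ∣ D) (n : ℤ)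
    (hn : (p : ℤ) ∣ (Qs j).eval n) : ¬ (p : ℤ) ∣ (Polynomial.derivative (Qs j)).eval n := by
  intro hd
  apply hpD
  apply hD p hp
  left
  refine ⟨n, (prime_dvd_prod_eval _ _ _ hp).2 ⟨j, hn⟩, ?_⟩
  rw [← Finset.mul_prod_erase Finset.univ Qs (Finset.mem_univ j), Polynomial.derivative_mul,
    Polynomial.eval_add, Polynomial.eval_mul, Polynomial.eval_mul]
  exact dvd_add (hd.mul_right _) (hn.mul_right _)

/-- The integers `n ∈ (x, x+y]` such that `|Q_j(n)| = a_j m_j` with `m_j` free of primes `≤ z`. -/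
noncomputable def roughSet {r : ℕ} (Qs : Fin r → Polynomial ℤ) (x y z : ℝ) (a : Fin r → ℕ) :
    Finset ℤ :=
  (intI x y).filter fun n => ∀ j, ∃ m : ℕ, 0 < m ∧ ((Qs j).eval n).natAbs = a j * m ∧
    ∀ p : ℕ, p.Prime → p ∣ m → z < (p : ℝ)

/-- Validity of a tuple `a`. -/
def ValidT {r : ℕ} (z : ℝ) (D : ℤ) (a : Fin r → ℕ) : Prop :=
  (∀ j, 1 ≤ a j ∧ (a j : ℝ) ≤ z) ∧ (∀ i j, i ≠ j → Nat.Coprime (a i) (a j)) ∧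
    ∀ j, ∀ p : ℕ, p.Prime → p ∣ a j → ¬ (p : ℤ) ∣ D

lemma roughSet_disjoint {r : ℕ} (Qs : Fin r → Polynomial ℤ) (x y z : ℝ) (D : ℤ)
    (a a' : Fin r → ℕ) (h : ValidT z D a) (h' : ValidT z D a') (hne : a ≠ a') :
    Disjoint (roughSet Qs x y z a) (roughSet Qs x y z a') := by
  rw [Finset.disjoint_left]
  intro n hn hn'
  apply hne
  funext j
  obtain ⟨m, _, hm1, hm2⟩ := (Finset.mem_filter.1 hn).2 j
  obtain ⟨m', _, hm1', hm2'⟩ := (Finset.mem_filter.1 hn').2 j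
  exact smooth_unique z _ _ m m' (h.1 j).1 (h'.1 j).1 (h.1 j).2 (h'.1 j).2 hm2 hm2'
    (hm1.symm.trans hm1')

lemma roughSet_lower {r : ℕ} (Qs : Fin r → Polynomial ℤ) (x y z : ℝ) (hz : 2 ≤ z) (D : ℤ)
    (hD : ∀ p : ℕ, p.Prime →
          ((∃ n : ℤ, (p : ℤ) ∣ (∏ j, Qs j).eval n ∧
              (p : ℤ) ∣ (Polynomial.derivative (∏ j, Qs j)).eval n) ∨
           (∃ i j : Fin r, i ≠ j ∧ ∃ n : ℤ,
              (p : ℤ) ∣ (Qs i).eval n ∧ (p : ℤ) ∣ (Qs j).eval n)) →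
          (p : ℤ) ∣ D)
    (a : Fin r → ℕ) (h : ValidT z D a) (K : ℝ) (hK : 0 ≤ K)
    (hs : ∀ P ⊆ primesBelow z, ∀ q : ℕ, q = (∏ j, a j) ^ 2 → (∀ p ∈ P, Nat.Coprime q p) →
      ∀ b : ℤ, K / q ≤ (((intI x y).filter fun n => n ≡ b [ZMOD q] ∧
        ∀ p ∈ P, ¬ (p : ℤ) ∣ (∏ j, Qs j).eval n).card : ℝ)) :
    K * ∏ j, (rho (Qs j) (a j) : ℝ) * (a j).totient / (a j : ℝ) ^ 2 ≤
      ((roughSet Qs x y z a).card : ℝ) := by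
  obtain ⟨ha, hcop, haD⟩ := h
  set P := (primesBelow z).filter fun p => ¬ p ∣ ∏ j, a j with hP
  set T : (Fin r → ℕ) → Finset ℤ := fun b => (intI x y).filter fun n =>
    (∀ j, n ≡ (b j : ℤ) [ZMOD ((a j ^ 2 : ℕ) : ℤ)]) ∧
      ∀ p ∈ P, ¬ (p : ℤ) ∣ (∏ j, Qs j).eval n with hT
  set A := ∏ j, a j with hA
  have hcop2 : ∀ i j, i ≠ j → Nat.Coprime (a i ^ 2) (a j ^ 2) := fun i j hij =>
    Nat.Coprime.pow 2 2 (hcop i j hij)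
  -- lower bound for each residue class
  have hTl : ∀ b, K / ((A ^ 2 : ℕ) : ℝ) ≤ ((T b).card : ℝ) := by
    intro b
    obtain ⟨c, hc⟩ := crt_fin (fun j => a j ^ 2) hcop2 (fun j => (b j : ℤ))
    have := hs P (Finset.filter_subset _ _) (A ^ 2) rfl (by
      intro p hp
      have hp' := Finset.mem_filter.1 hp
      have hpp : p.Prime := (Finset.mem_filter.1 hp'.1).2
      exact Nat.Coprime.pow_left 2 ((Nat.Prime.coprime_iff_not_dvd hpp).2 hp'.2).symm) c
    refine this.trans_eq ?_
    congr 2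
    simp only [hT]
    apply Finset.filter_congr
    intro n _
    rw [hc n, Finset.prod_pow]
  have hdisj : ((Fintype.piFinset fun j => goodCl (Qs j) (a j) : Finset (Fin r → ℕ)) :
      Set (Fin r → ℕ)).PairwiseDisjoint T := by
    intro b hb b' hb' hne
    change Disjoint (T b) (T b')
    rw [Finset.disjoint_left]
    intro n hn hn'
    apply hne
    funext j
    have h1 := (Finset.mem_filter.1 hn).2.1 j
    have h2 := (Finset.mem_filter.1 hn').2.1 j
    have hbj := ((mem_goodCl _ _ _).1 (Fintype.mem_piFinset.1 (Finset.mem_coe.1 hb) j)).1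
    have hbj' := ((mem_goodCl _ _ _).1 (Fintype.mem_piFinset.1 (Finset.mem_coe.1 hb') j)).1
    exact Nat.ModEq.eq_of_lt_of_lt (Int.natCast_modEq_iff.1 (h1.symm.trans h2)) hbj hbj'
  have hsub : (Fintype.piFinset fun j => goodCl (Qs j) (a j)).biUnion T ⊆ roughSet Qs x y z a := by
    intro n hn
    obtain ⟨b, hb, hn⟩ := Finset.mem_biUnion.1 hn
    obtain ⟨hnI, hmod, hsv⟩ := Finset.mem_filter.1 hn
    refine Finset.mem_filter.2 ⟨hnI, fun j => ?_⟩
    have hg : ∀ i, ∃ m : ℤ, (Qs i).eval n = a i * m ∧ IsCoprime m (a i : ℤ) := fun i =>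
      goodCl_congr (Qs i) (a i) (b i) (ha i).1 (Fintype.mem_piFinset.1 hb i) n (hmod i)
    obtain ⟨m, hm, hmc⟩ := hg j
    have hrough : ∀ p : ℕ, p.Prime → (p : ℤ) ∣ m → z < (p : ℝ) := by
      intro p hp hpm
      by_contra hpz
      push Not at hpz
      have hpj : (p : ℤ) ∣ (Qs j).eval n := hm ▸ hpm.mul_left _
      by_cases hpA : p ∣ A
      · obtain ⟨i, _, hi⟩ := (Prime.dvd_finsetProd_iff hp.prime _).1 hpA
        by_cases hij : i = j
        · subst hij
          have := hmc.isUnit_of_dvd' hpm (Int.natCast_dvd_natCast.2 hi)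
          exact (Nat.prime_iff_prime_int.1 hp).not_isUnit this
        · apply haD i p hp hi
          apply hD p hp
          right
          obtain ⟨m', hm', _⟩ := hg i
          exact ⟨i, j, hij, n, hm' ▸ (Int.natCast_dvd_natCast.2 hi).mul_right _, hpj⟩
      · refine hsv p (Finset.mem_filter.2 ⟨Finset.mem_filter.2 ⟨?_, hp⟩, hpA⟩)
          ((prime_dvd_prod_eval _ _ _ hp).2 ⟨j, hpj⟩)
        exact Finset.mem_range.2 (Nat.lt_succ_of_le (Nat.le_floor hpz))
    refine ⟨m.natAbs, ?_, ?_, ?_⟩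
    · apply Int.natAbs_pos.2
      rintro rfl
      have := hrough 2 Nat.prime_two (dvd_zero _)
      push_cast at this
      linarith
    · rw [hm, Int.natAbs_mul]; simp
    · intro p hp hpm
      exact hrough p hp (Int.natCast_dvd.2 hpm)
  have hder : ∀ j, rho (Qs j) (a j) * (a j).totient ≤ (goodCl (Qs j) (a j)).card := fun j =>
    good_card _ _ (ha j).1 fun p hp hpa n hn => deriv_cond Qs D hD j p hp (haD j p hp hpa) n hn
  have hA0 : (0 : ℝ) < ((A ^ 2 : ℕ) : ℝ) := by
    have : 0 < A := Finset.prod_pos fun j _ => (ha j).1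
    positivity
  calc K * ∏ j, (rho (Qs j) (a j) : ℝ) * (a j).totient / (a j : ℝ) ^ 2
      = (∏ j, (rho (Qs j) (a j) : ℝ) * (a j).totient) * (K / ((A ^ 2 : ℕ) : ℝ)) := by
        rw [Finset.prod_div_distrib, Finset.prod_pow, hA]
        push_cast
        ring
    _ ≤ (∏ j, ((goodCl (Qs j) (a j)).card : ℝ)) * (K / ((A ^ 2 : ℕ) : ℝ)) := by
        apply mul_le_mul_of_nonneg_right _ (by positivity)
        apply Finset.prod_le_prod
        · intro j _; positivity
        · intro j _; exact_mod_cast hder j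
    _ = ∑ b ∈ Fintype.piFinset fun j => goodCl (Qs j) (a j), K / ((A ^ 2 : ℕ) : ℝ) := by
        rw [Finset.sum_const, Fintype.card_piFinset, nsmul_eq_mul]
        push_cast
        rfl
    _ ≤ ∑ b ∈ Fintype.piFinset fun j => goodCl (Qs j) (a j), ((T b).card : ℝ) :=
        Finset.sum_le_sum fun b _ => hTl b
    _ = (((Fintype.piFinset fun j => goodCl (Qs j) (a j)).biUnion T).card : ℝ) := by
        rw [Finset.card_biUnion hdisj]
        push_cast
        rfl
    _ ≤ _ := by exact_mod_cast Finset.card_le_card hsub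

set_option maxHeartbeats 1000000

/-- First part of Theorem 2 of the paper (lower bound). Fix `r, g, 𝔙 ≥ 1` and
`0 < ε, δ < 1`, and set `ε₀ := ε/(50g)`. There exist `c₀, c₂ > 0` depending only on these
parameters such that under the stated hypotheses,
`sup_{k} #{x < n ≤ x+y : f_j(Q_j(n)) = k_j ∀j} ≥
  c₂ · e^{−M} · y/(log x)^r · sup_{k} ∑_{a₁,…,a_r} ∏_j ρ_j(a_j)φ(a_j)/a_j²`,
the inner sum being over `r`-tuples of pairwise coprime positive integers `a_j ≤ x^{ε₀}`
coprime to `βD` with `f_j(a_j) = k_j`. The inequality between suprema is expressed as: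
for every tuple `k` (indexing the right-hand side) there is a tuple `k'` (indexing the
left-hand side) realizing the bound. -/
theorem statement4 (r g V : ℕ) (ε δ : ℝ)
    (hr : 1 ≤ r) (hg : 1 ≤ g) (hV : 1 ≤ V)
    (hε : 0 < ε) (hε1 : ε < 1) (hδ : 0 < δ) (hδ1 : δ < 1) :
    ∃ c₀ c₂ : ℝ, 0 < c₀ ∧ 0 < c₂ ∧
      ∀ (Qs : Fin r → Polynomial ℤ) (D : ℤ) (Mj : Fin r → ℝ)
        (x y : ℝ) (f : Fin r → ℕ → ℝ),
        (∀ j, Irreducible (Qs j)) →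
        (∀ i j, i ≠ j → IsRelPrime (Qs i) (Qs j)) →
        (∏ j, Qs j).natDegree = g →
        (∀ p : ℕ, p.Prime → rho (∏ j, Qs j) p < p) →
        D ≠ 0 →
        (∀ p : ℕ, p.Prime →
          ((∃ n : ℤ, (p : ℤ) ∣ (∏ j, Qs j).eval n ∧
              (p : ℤ) ∣ (Polynomial.derivative (∏ j, Qs j)).eval n) ∨
           (∃ i j : Fin r, i ≠ j ∧ ∃ n : ℤ,
              (p : ℤ) ∣ (Qs i).eval n ∧ (p : ℤ) ∣ (Qs j).eval n)) →
          (p : ℤ) ∣ D) →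
        (∀ j, 1 ≤ Mj j) →
        (∀ j, ∀ t : ℝ, 2 ≤ t →
          |(∑ p ∈ primesBelow t, (rho (Qs j) p : ℝ) / p) - Real.log (Real.log t)| ≤ Mj j) →
        c₀ * polyNorm (∏ j, Qs j) ^ δ ≤ x → x ^ ε < y → y ≤ x →
        (∀ j, ∀ m n : ℕ, Nat.Coprime m n → f j (m * n) = f j m + f j n) →
        -- condition (⁎'): `#{f_j(n) : n ≤ t^u, P⁻(n) > t} ≤ 𝔙^u` for `t ≥ x^{ε₀}`, `u ≥ 1`
        (∀ j, ∀ t u : ℝ, x ^ (ε / (50 * g)) ≤ t → 1 ≤ u →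
          (({v : ℝ | ∃ n : ℕ, 0 < n ∧ (n : ℝ) ≤ t ^ u ∧
              (∀ p : ℕ, p.Prime → p ∣ n → t < (p : ℝ)) ∧ f j n = v}).ncard : ℝ) ≤
            (V : ℝ) ^ u) →
        -- conclusion: `sup_{k'} LHS(k') ≥ c₂ e^{−M} y/(log x)^r · sup_k RHS(k)`
        ∀ k : Fin r → ℝ, ∃ k' : Fin r → ℝ,
          c₂ * Real.exp (-(∑ j, Mj j)) * (y / (Real.log x) ^ r) *
            (∑ a ∈ Fintype.piFinset fun _ : Fin r => Finset.Icc 1 ⌊x ^ (ε / (50 * g))⌋₊,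
              if (∀ j, f j (a j) = k j) ∧
                  (∀ i j, i ≠ j → Nat.Coprime (a i) (a j)) ∧
                  (∀ j, Nat.Coprime (a j) ((∏ j, Qs j).leadingCoeff * D).natAbs) then
                ∏ j, (rho (Qs j) (a j) : ℝ) * (a j).totient / (a j : ℝ) ^ 2
              else 0) ≤
          (({n : ℤ | x < (n : ℝ) ∧ (n : ℝ) ≤ x + y ∧
              ∀ j, extZ (f j) ((Qs j).eval n) = k' j}).ncard : ℝ) := by
  obtain ⟨z₀, hz₀, hsieve⟩ := sieve_lower g hg
  obtain ⟨c, hc, hdens⟩ := sieve_density r g hg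
  have hg0 : (1 : ℝ) ≤ g := by exact_mod_cast hg
  set e : ℝ := ε / (50 * g) with he
  have he0 : 0 < e := by positivity
  have he1 : e ≤ 1 := by
    rw [he, div_le_one (by positivity)]; linarith
  set u : ℝ := (2 * g + 1 + 1 / δ) / e with hu
  have hu1 : 1 ≤ u := by
    rw [hu, le_div_iff₀ he0]
    have : 0 < 1 / δ := by positivity
    linarith
  have hVu : 0 < (V : ℝ) ^ u := Real.rpow_pos_of_pos (by exact_mod_cast hV) _
  set c₀ : ℝ := z₀ ^ (1 / e) + g + 2 with hc₀
  have hz₀p : 0 < z₀ ^ (1 / e) := Real.rpow_pos_of_pos (by linarith) _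
  refine ⟨c₀, c / (4 * ((V : ℝ) ^ u) ^ r), by linarith, by positivity, ?_⟩
  intro Qs D Mj x y f hirr hrel hdeg hfix hD0 hD hM1 hM hx hxy hyx hadd hvals k
  set Q := ∏ j, Qs j with hQ
  have hQ0 : Q ≠ 0 := Finset.prod_ne_zero_iff.2 fun j _ => (hirr j).ne_zero
  have hnorm := one_le_polyNorm Q hQ0
  have hnδ : 1 ≤ polyNorm Q ^ δ := Real.one_le_rpow hnorm hδ.le
  have hxc : c₀ ≤ x := by
    refine le_trans ?_ hx
    exact le_mul_of_one_le_right (by linarith) hnδ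
  have hx2 : 2 ≤ x := by linarith
  have hxg : (g : ℝ) + 1 ≤ x := by linarith
  have hx0 : 0 < x := by linarith
  have hnx : polyNorm Q ≤ x ^ (1 / δ) := by
    have h1 : polyNorm Q ^ δ ≤ x := by
      refine le_trans ?_ hx
      exact le_mul_of_one_le_left (by linarith) (by linarith)
    calc polyNorm Q = (polyNorm Q ^ δ) ^ (1 / δ) := by
          rw [← Real.rpow_mul (by linarith), mul_one_div_cancel hδ.ne', Real.rpow_one]
      _ ≤ _ := Real.rpow_le_rpow (by linarith) h1 (by positivity)
  set z : ℝ := x ^ e with hz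
  have hzz₀ : z₀ ≤ z := by
    calc z₀ = (z₀ ^ (1 / e)) ^ e := by
          rw [← Real.rpow_mul (by linarith), one_div_mul_cancel he0.ne', Real.rpow_one]
      _ ≤ x ^ e := Real.rpow_le_rpow hz₀p.le (by linarith) he0.le
  have hz2 : 2 ≤ z := hz₀.trans hzz₀
  have hy0 : 0 ≤ y := (Real.rpow_pos_of_pos hx0 ε).le.trans hxy.le
  have hzx : z ≤ x := by
    calc x ^ e ≤ x ^ (1 : ℝ) := Real.rpow_le_rpow_of_exponent_le (by linarith) he1
      _ = x := Real.rpow_one x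
  have hlogz : 0 < Real.log z := Real.log_pos (by linarith)
  have hlogzx : Real.log z ≤ Real.log x := Real.log_le_log (by linarith) hzx
  have hlogx : 0 < Real.log x := by linarith
  have hrg : r ≤ g := hdeg ▸ r_le_g Qs hirr hfix
  have hz50 : z ^ (50 * g) < y := by
    refine lt_of_eq_of_lt ?_ hxy
    rw [hz, ← Real.rpow_natCast, ← Real.rpow_mul hx0.le, he]
    congr 1
    push_cast
    field_simp
  -- the sieve bound
  set K : ℝ := 1 / 4 * y * (c * Real.exp (-∑ j, Mj j) / (Real.log x) ^ r) with hK
  have hK0 : 0 ≤ K := by positivity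
  have hlow : ∀ a : Fin r → ℕ, ValidT z D a →
      K * ∏ j, (rho (Qs j) (a j) : ℝ) * (a j).totient / (a j : ℝ) ^ 2 ≤
      ((roughSet Qs x y z a).card : ℝ) := by
    intro a ha
    apply roughSet_lower Qs x y z hz2 D hD a ha K hK0
    intro P hP q hq hqP b
    have hA1 : 1 ≤ ∏ j, a j := Nat.succ_le_of_lt (Finset.prod_pos fun j _ => (ha.1 j).1)
    have hq1 : 1 ≤ q := by rw [hq]; exact Nat.one_le_pow _ _ hA1
    have hq0 : (0 : ℝ) < q := by exact_mod_cast hq1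
    have hqz : (q : ℝ) ≤ z ^ (2 * g) := by
      rw [hq]; push_cast
      calc (∏ j, (a j : ℝ)) ^ 2 ≤ (∏ _j : Fin r, z) ^ 2 := by
            apply pow_le_pow_left₀ (Finset.prod_nonneg fun j _ => by positivity)
            exact Finset.prod_le_prod (fun j _ => by positivity) fun j _ => (ha.1 j).2
        _ = z ^ (2 * r) := by simp; ring
        _ ≤ z ^ (2 * g) := pow_le_pow_right₀ (by linarith) (by omega)
    have hzy : z ^ (48 * g) ≤ y / q := by
      rw [le_div_iff₀ hq0]
      calc z ^ (48 * g) * q ≤ z ^ (48 * g) * z ^ (2 * g) := by gcongr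
        _ = z ^ (50 * g) := by rw [← pow_add]; congr 1; ring
        _ ≤ y := hz50.le
    have h1 := hsieve Q hdeg.le hfix z hzz₀ P (fun p hp => by
      have := Finset.mem_filter.1 (hP hp)
      refine ⟨this.2, ?_⟩
      exact (Nat.le_floor_iff (by linarith)).1 (Nat.lt_succ_iff.1 (Finset.mem_range.1 this.1)))
      q hq1 hqP b x y hy0 hzy
    refine le_trans ?_ h1
    have h2 := hdens Qs Mj hdeg.le hfix z hz2 (fun j => (abs_le.1 (hM j z hz2)).2) P hP
    have h3 : c * Real.exp (-∑ j, Mj j) / (Real.log x) ^ r ≤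
        c * Real.exp (-∑ j, Mj j) / (Real.log z) ^ r := by gcongr
    calc K / q = 1 / 4 * (y / q) * (c * Real.exp (-∑ j, Mj j) / (Real.log x) ^ r) := by
          rw [hK]; ring
      _ ≤ _ := by
        apply mul_le_mul_of_nonneg_left (h3.trans h2)
        positivity
  -- collecting the tuples
  set cond : (Fin r → ℕ) → Prop := fun a => (∀ j, f j (a j) = k j) ∧
                  (∀ i j, i ≠ j → Nat.Coprime (a i) (a j)) ∧
                  (∀ j, Nat.Coprime (a j) (Q.leadingCoeff * D).natAbs) with hcond
  set S := (Fintype.piFinset fun _ : Fin r => Finset.Icc 1 ⌊z⌋₊).filter cond with hS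
  have hvalid : ∀ a ∈ S, ValidT z D a := by
    intro a ha
    obtain ⟨h1, _, h3, h4⟩ := Finset.mem_filter.1 ha
    refine ⟨fun j => ?_, h3, fun j p hp hpa hpD => ?_⟩
    · have := Finset.mem_Icc.1 (Fintype.mem_piFinset.1 h1 j)
      exact ⟨this.1, (Nat.le_floor_iff (by linarith)).1 this.2⟩
    · have h5 : p ∣ (Q.leadingCoeff * D).natAbs := Int.natCast_dvd.1 (hpD.mul_left _)
      exact Nat.not_coprime_of_dvd_of_dvd hp.one_lt hpa h5 (h4 j)
  set U := S.biUnion (roughSet Qs x y z) with hU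
  have hUcard : K * ∑ a ∈ S, ∏ j, (rho (Qs j) (a j) : ℝ) * (a j).totient / (a j : ℝ) ^ 2 ≤
      (U.card : ℝ) := by
    rw [hU, Finset.card_biUnion, Finset.mul_sum]
    · push_cast
      exact Finset.sum_le_sum fun a ha => hlow a (hvalid a ha)
    · intro a ha a' ha' hne
      exact roughSet_disjoint Qs x y z D a a' (hvalid a ha) (hvalid a' ha') hne
  -- the values
  set F : Fin r → Set ℝ := fun j => {v : ℝ | ∃ n : ℕ, 0 < n ∧ (n : ℝ) ≤ z ^ u ∧
              (∀ p : ℕ, p.Prime → p ∣ n → z < (p : ℝ)) ∧ f j n = v} with hF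
  have hFfin : ∀ j, (F j).Finite := by
    intro j
    apply ((Set.finite_Iic ⌊z ^ u⌋₊).image (f j)).subset
    rintro v ⟨n, _, h2, _, rfl⟩
    exact ⟨n, Nat.le_floor h2, rfl⟩
  have hFcard : ∀ j, ((hFfin j).toFinset.card : ℝ) ≤ (V : ℝ) ^ u := by
    intro j
    rw [← Set.ncard_eq_toFinset_card _ (hFfin j)]
    exact hvals j z u le_rfl hu1
  set W : Finset (Fin r → ℝ) := Fintype.piFinset fun j => (hFfin j).toFinset.image (k j + ·) with hW
  have hWne : W.Nonempty := by
    refine ⟨fun j => k j + f j 1, Fintype.mem_piFinset.2 fun j => Finset.mem_image.2 ⟨f j 1, ?_, rfl⟩⟩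
    rw [Set.Finite.mem_toFinset]
    refine ⟨1, one_pos, ?_, ?_, rfl⟩
    · push_cast
      exact Real.one_le_rpow (by linarith) (by linarith)
    · intro p hp hp1
      exact absurd (Nat.dvd_one.1 hp1) hp.ne_one
  have hWcard : (W.card : ℝ) ≤ ((V : ℝ) ^ u) ^ r := by
    rw [hW, Fintype.card_piFinset]
    push_cast
    calc _ ≤ ∏ _j : Fin r, (V : ℝ) ^ u := by
          apply Finset.prod_le_prod
          · intro j _; positivity
          · intro j _
            refine le_trans ?_ (hFcard j)
            exact_mod_cast Finset.card_image_le
      _ = _ := by simp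
  have hzu : z ^ u = x ^ (2 * g + 1 + 1 / δ : ℝ) := by
    rw [hz, ← Real.rpow_mul hx0.le, hu, mul_div_cancel₀ _ he0.ne']
  have hsize : ∀ n ∈ intI x y, |((Q.eval n : ℤ) : ℝ)| ≤ z ^ u := by
    intro n hn
    rw [mem_intI] at hn
    have hn2 : |(n : ℝ)| ≤ 2 * x := by
      rw [abs_of_pos (by linarith)]; linarith
    refine (eval_bound Q n (2 * x) (by linarith) hn2).trans ?_
    rw [hdeg, hzu]
    have h2x : (2 * x) ^ g ≤ x ^ (2 * g : ℝ) := by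
      have : x ^ (2 * g : ℝ) = (x * x) ^ g := by
        rw [show (2 * g : ℝ) = ((2 * g : ℕ) : ℝ) by push_cast; ring, Real.rpow_natCast, pow_mul]
        congr 1; ring
      rw [this]
      apply pow_le_pow_left₀ (by linarith)
      nlinarith
    calc ((g : ℝ) + 1) * polyNorm Q * (2 * x) ^ g ≤ x * x ^ (1 / δ) * x ^ (2 * g : ℝ) := by gcongr
      _ = x ^ (2 * g + 1 + 1 / δ : ℝ) := by
        rw [Real.rpow_add hx0, Real.rpow_add hx0, Real.rpow_one]; ring
  have hmaps : ∀ n ∈ U, (fun j => extZ (f j) ((Qs j).eval n)) ∈ W := by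
    intro n hn
    obtain ⟨a, ha, hn⟩ := Finset.mem_biUnion.1 hn
    obtain ⟨hnI, hnr⟩ := Finset.mem_filter.1 hn
    have hva := hvalid a ha
    have hne : ∀ j, (Qs j).eval n ≠ 0 := by
      intro j h0
      obtain ⟨m, hm0, hm, _⟩ := hnr j
      rw [h0] at hm
      have := Nat.mul_pos (hva.1 j).1 hm0
      rw [Int.natAbs_zero] at hm
      exact this.ne hm
    refine Fintype.mem_piFinset.2 fun j => Finset.mem_image.2 ?_
    obtain ⟨m, hm0, hm, hmp⟩ := hnr j
    refine ⟨f j m, ?_, ?_⟩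
    · rw [Set.Finite.mem_toFinset]
      refine ⟨m, hm0, ?_, hmp, rfl⟩
      refine le_trans ?_ (hsize n hnI)
      have h1 : m ≤ (Q.eval n).natAbs := by
        apply Nat.le_of_dvd
        · apply Int.natAbs_pos.2
          rw [hQ, eval_prod_fin]
          exact Finset.prod_ne_zero_iff.2 fun i _ => hne i
        · have h2 : (Qs j).eval n ∣ Q.eval n := by
            rw [hQ, eval_prod_fin]
            exact Finset.dvd_prod_of_mem _ (Finset.mem_univ j)
          exact (Dvd.intro_left _ hm.symm).trans (Int.natAbs_dvd_natAbs.2 h2)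
      have h3 : |((Q.eval n : ℤ) : ℝ)| = (((Q.eval n).natAbs : ℕ) : ℝ) := by
        rw [Nat.cast_natAbs]; simp
      rw [h3]
      exact_mod_cast h1
    · have hco : Nat.Coprime (a j) m := by
        apply Nat.Coprime.symm
        apply Nat.coprime_of_dvd
        intro p hp hpm hpa
        have h1 := hmp p hp hpm
        have h2 : (p : ℝ) ≤ a j := by exact_mod_cast Nat.le_of_dvd (hva.1 j).1 hpa
        linarith [(hva.1 j).2]
      have hk := (Finset.mem_filter.1 ha).2.1 j
      simp only [extZ, if_neg (hne j), hm, hadd j _ _ hco, hk]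
  -- pigeonhole
  obtain ⟨k', _, hk'⟩ := Finset.exists_le_card_fiber_of_nsmul_le_card_of_maps_to
    (M := ℝ) (b := (U.card : ℝ) / W.card) hmaps hWne (by
      rw [nsmul_eq_mul, mul_div_cancel₀]
      exact_mod_cast hWne.card_pos.ne')
  refine ⟨k', ?_⟩
  rw [← Finset.sum_filter]
  have hfin : ({n : ℤ | x < (n : ℝ) ∧ (n : ℝ) ≤ x + y ∧
              ∀ j, extZ (f j) ((Qs j).eval n) = k' j}).Finite := by
    apply (intI x y).finite_toSet.subset
    intro n hn
    exact Finset.mem_coe.2 ((mem_intI _ _ _).2 ⟨hn.1, hn.2.1⟩)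
  have hsubs : (((U.filter fun n => (fun j => extZ (f j) ((Qs j).eval n)) = k').card : ℕ) : ℝ) ≤
      (({n : ℤ | x < (n : ℝ) ∧ (n : ℝ) ≤ x + y ∧
              ∀ j, extZ (f j) ((Qs j).eval n) = k' j}).ncard : ℝ) := by
    rw [← Set.ncard_coe_finset]
    apply Nat.cast_le.2
    apply Set.ncard_le_ncard _ hfin
    intro n hn
    obtain ⟨hn1, hn2⟩ := Finset.mem_filter.1 (Finset.mem_coe.1 hn)
    obtain ⟨a, ha, hn1⟩ := Finset.mem_biUnion.1 hn1
    have := (mem_intI _ _ _).1 (Finset.mem_filter.1 hn1).1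
    exact ⟨this.1, this.2, fun j => congrFun hn2 j⟩
  refine le_trans ?_ hsubs
  refine le_trans ?_ hk'
  have hW0 : (0 : ℝ) < W.card := by exact_mod_cast hWne.card_pos
  set tot := ∑ a ∈ S, ∏ j, (rho (Qs j) (a j) : ℝ) * (a j).totient / (a j : ℝ) ^ 2 with htot
  calc c / (4 * ((V : ℝ) ^ u) ^ r) * Real.exp (-(∑ j, Mj j)) * (y / (Real.log x) ^ r) * tot
      = K * tot / ((V : ℝ) ^ u) ^ r := by
        have aux : ∀ c Y E y L t : ℝ, c / (4 * Y) * E * (y / L) * t =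
            1 / 4 * y * (c * E / L) * t / Y := by
          intro c Y E y L t
          rw [div_mul_eq_div_div]
          ring
        rw [hK]
        exact aux _ _ _ _ _ _
    _ ≤ U.card / ((V : ℝ) ^ u) ^ r := div_le_div_of_nonneg_right hUcard (by positivity)
    _ ≤ U.card / W.card := div_le_div_of_nonneg_left (Nat.cast_nonneg _) hW0 hWcard
end

section
/- Let Q₁, …, Q_r ∈ ℤ[X] be irreducible polynomials, pairwise coprime, such that Q := ∏_{j=1}^r Q_j has no fixed prime divisor; let β be the leading coefficient of Q and let D be a nonzero integer divisible by every prime p modulo which Q has a repeated root or modulo which two of the Q_j share a common root. Then for all positive integers a₁, …, a_r that are pairwise coprime and each coprime to βD, one has ρ̌(a₁, …, a_r) / ∏_{j=1}^r (a_j·κ(a_j)) ≥ ∏_{j=1}^r ρ_j(a_j)·φ(a_j)/a_j², where ρ̌(a₁, …, a_r) := #{n mod ∏_{j=1}^r a_j κ(a_j) : a_j ∥ Q_j(n) for all 1 ≤ j ≤ r, and a₁⋯a_r ∥ Q(n)}. -/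
open scoped Classical

/-- `κ(n)` : the radical (squarefree kernel) of `n`. -/
noncomputable def rad (n : ℕ) : ℕ := ∏ p ∈ n.primeFactors, p

/-- `a ∥ m` : `a` is a unitary divisor of `m`, i.e. `a ∣ m` and `gcd(a, m/a) = 1`.
(For `m = 0` this holds only when `a = 1`, which encodes the requirement `m ≠ 0`
for `a > 1`.) -/
noncomputable def unitaryDvd (a : ℕ) (m : ℤ) : Prop :=
  (a : ℤ) ∣ m ∧ Int.gcd (a : ℤ) (m / (a : ℤ)) = 1

/-- `ρ̌(a₁, …, a_r)` : the number of residues `n` modulo `∏_j a_j κ(a_j)` such that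
`a_j ∥ Q_j(n)` for all `j` and `a₁⋯a_r ∥ Q(n)` (where `Q = ∏_j Q_j`). These conditions
only depend on `n` modulo `∏_j a_j κ(a_j)`. -/
noncomputable def rhoCheck {r : ℕ} (Qs : Fin r → Polynomial ℤ) (a : Fin r → ℕ) : ℕ :=
  ((Finset.range (∏ j, a j * rad (a j))).filter fun n =>
    (∀ j, unitaryDvd (a j) ((Qs j).eval (n : ℤ))) ∧
      unitaryDvd (∏ j, a j) ((∏ j, Qs j).eval (n : ℤ))).card

theorem aux_card (P : ℤ → Prop) (s : Finset ℕ) :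
    (Finset.filter P (do let a ← s; pure (a : ℤ))).card =
      (Finset.filter (fun n : ℕ => P (n : ℤ)) s).card := by
  have h : (do let a ← s; pure (a : ℤ) : Finset ℤ) = s.image (fun n : ℕ => (n : ℤ)) := by
    ext x
    simp [Finset.bind_def, Finset.mem_sup, Finset.pure_def, eq_comm]
  rw [h, Finset.filter_image, Finset.card_image_of_injective _ Nat.cast_injective]

theorem aux_rho (Q : Polynomial ℤ) (m : ℕ) :
    rho Q m = ((Finset.range m).filter fun n : ℕ => (m : ℤ) ∣ Q.eval (n : ℤ)).card := by
  unfold rho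
  convert aux_card (fun n => (m : ℤ) ∣ Q.eval n) (Finset.range m)

theorem aux_rhoCheck {r : ℕ} (Qs : Fin r → Polynomial ℤ) (a : Fin r → ℕ) :
    rhoCheck Qs a = ((Finset.range (∏ j, a j * rad (a j))).filter fun n : ℕ =>
    (∀ j, unitaryDvd (a j) ((Qs j).eval (n : ℤ))) ∧
      unitaryDvd (∏ j, a j) ((∏ j, Qs j).eval (n : ℤ))).card := by
  unfold rhoCheck
  convert aux_card (fun n => (∀ j, unitaryDvd (a j) ((Qs j).eval n)) ∧
      unitaryDvd (∏ j, a j) ((∏ j, Qs j).eval n)) (Finset.range (∏ j, a j * rad (a j)))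

theorem aux_rad_dvd (a : ℕ) : rad a ∣ a := Nat.prod_primeFactors_dvd a

theorem aux_rad_pos (a : ℕ) : 0 < rad a :=
  Finset.prod_pos fun p hp => (Nat.prime_of_mem_primeFactors hp).pos

theorem aux_isCoprime_of_prime (a : ℕ) (c : ℤ)
    (h : ∀ p : ℕ, p.Prime → p ∣ a → ¬ (p : ℤ) ∣ c) : IsCoprime (a : ℤ) c := by
  rw [Int.isCoprime_iff_gcd_eq_one]
  by_contra hne
  obtain ⟨p, hp, hpd⟩ := Nat.exists_prime_and_dvd hne
  have h1 : (p : ℤ) ∣ (a : ℤ) := (Int.natCast_dvd_natCast.mpr hpd).trans (Int.gcd_dvd_left _ _)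
  exact h p hp (Int.natCast_dvd_natCast.mp h1)
    ((Int.natCast_dvd_natCast.mpr hpd).trans (Int.gcd_dvd_right _ _))

theorem aux_not_dvd (a : ℕ) (c : ℤ) (h : IsCoprime (a : ℤ) c) (p : ℕ) (hp : p.Prime)
    (hpa : p ∣ a) : ¬ (p : ℤ) ∣ c := by
  intro hc
  have := h.isUnit_of_dvd' (Int.natCast_dvd_natCast.mpr hpa) hc
  exact (Nat.prime_iff_prime_int.mp hp).not_isUnit this

theorem aux_coprime_rad (a : ℕ) (ha : 0 < a) (c : ℤ) (h : IsCoprime (rad a : ℤ) c) :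
    IsCoprime (a : ℤ) c := by
  apply aux_isCoprime_of_prime
  intro p hp hpa
  refine aux_not_dvd (rad a) c h p hp ?_
  exact Finset.dvd_prod_of_mem _ (Nat.mem_primeFactors.mpr ⟨hp, hpa, ha.ne'⟩)

theorem aux_unitary (a : ℕ) (ha : 0 < a) (m : ℤ) :
    unitaryDvd a m ↔ ∃ c, m = a * c ∧ IsCoprime (a : ℤ) c := by
  have ha' : (a : ℤ) ≠ 0 := by exact_mod_cast ha.ne'
  unfold unitaryDvd
  constructor
  · rintro ⟨⟨c, rfl⟩, h⟩
    rw [Int.mul_ediv_cancel_left _ ha'] at h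
    exact ⟨c, rfl, Int.isCoprime_iff_gcd_eq_one.mpr h⟩
  · rintro ⟨c, rfl, h⟩
    rw [Int.mul_ediv_cancel_left _ ha']
    exact ⟨dvd_mul_right _ _, Int.isCoprime_iff_gcd_eq_one.mp h⟩

theorem aux_totient (a : ℕ) : a.totient * rad a = (rad a).totient * a := by
  have h1 := Nat.totient_mul_prod_primeFactors a
  have h2 := Nat.totient_mul_prod_primeFactors (rad a)
  have h3 : (rad a).primeFactors = a.primeFactors :=
    Nat.primeFactors_prod fun p hp => Nat.prime_of_mem_primeFactors hp
  rw [h3] at h2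
  change _ * rad a = _ at h1
  change _ * rad a = _ at h2
  have h4 : (rad a).totient = ∏ p ∈ a.primeFactors, (p - 1) := by
    apply Nat.eq_of_mul_eq_mul_right (aux_rad_pos a)
    rw [h2, mul_comm]
  rw [h1, h4, mul_comm]

theorem aux_unitary_periodic (a : ℕ) (ha : 0 < a) (Q : Polynomial ℤ) (x y : ℕ)
    (hxy : x ≡ y [MOD a * rad a]) (h : unitaryDvd a (Q.eval (x : ℤ))) :
    unitaryDvd a (Q.eval (y : ℤ)) := by
  rw [aux_unitary a ha] at h ⊢
  obtain ⟨c, hc, hcop⟩ := h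
  have h1 : ((a * rad a : ℕ) : ℤ) ∣ (y : ℤ) - x := (Nat.modEq_iff_dvd).mp hxy
  obtain ⟨d, hd⟩ := h1.trans (Polynomial.sub_dvd_eval_sub (y : ℤ) x Q)
  push_cast at hd
  refine ⟨c + rad a * d, by linear_combination hd + hc, ?_⟩
  apply aux_coprime_rad a ha
  have h2 : IsCoprime (rad a : ℤ) c :=
    hcop.of_isCoprime_of_dvd_left (Int.natCast_dvd_natCast.mpr (aux_rad_dvd a))
  exact IsCoprime.add_mul_left_right h2 d

theorem aux_crt {r : ℕ} (m : Fin r → ℕ) (hm : ∀ j, 0 < m j)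
    (hcop : ∀ i j, i ≠ j → Nat.Coprime (m i) (m j)) (P : Fin r → ℕ → Prop)
    (hP : ∀ j x y, x ≡ y [MOD m j] → P j x → P j y) :
    ∏ j, ((Finset.range (m j)).filter (P j)).card ≤
      ((Finset.range (∏ j, m j)).filter fun n => ∀ j, P j n).card := by
  rw [← Fintype.card_piFinset]
  have hex : ∀ f : Fin r → ℕ, ∃ k, k < ∏ j, m j ∧ ∀ j, k ≡ f j [MOD m j] := by
    intro f
    obtain ⟨k, hk⟩ := Nat.chineseRemainderOfFinset f m Finset.univ
      (fun i _ => (hm i).ne') (fun i _ j _ hij => hcop i j hij)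
    refine ⟨k % ∏ j, m j, Nat.mod_lt _ (Finset.prod_pos fun j _ => hm j), fun j => ?_⟩
    refine Nat.ModEq.trans ?_ (hk j (Finset.mem_univ j))
    exact (Nat.mod_modEq k _).of_dvd (Finset.dvd_prod_of_mem m (Finset.mem_univ j))
  choose g hg1 hg2 using hex
  refine Finset.card_le_card_of_injOn g ?_ ?_
  · intro f hf
    have hf := Fintype.mem_piFinset.mp (Finset.mem_coe.mp hf)
    refine Finset.mem_coe.mpr (Finset.mem_filter.mpr ⟨Finset.mem_range.mpr (hg1 f), fun j => ?_⟩)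
    exact hP j _ _ (hg2 f j).symm (Finset.mem_filter.mp (hf j)).2
  · intro f hf f' hf' hff
    have hf := Fintype.mem_piFinset.mp (Finset.mem_coe.mp hf)
    have hf' := Fintype.mem_piFinset.mp (Finset.mem_coe.mp hf')
    funext j
    have h1 : f j ≡ f' j [MOD m j] := by
      have := (hg2 f j).symm
      rw [hff] at this
      exact this.trans (hg2 f' j)
    exact h1.eq_of_lt_of_lt (Finset.mem_range.mp (Finset.mem_filter.mp (hf j)).1)
      (Finset.mem_range.mp (Finset.mem_filter.mp (hf' j)).1)

theorem aux_local (a : ℕ) (ha : 0 < a) (Q : Polynomial ℤ)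
    (hQ : ∀ n : ℤ, (a : ℤ) ∣ Q.eval n → IsCoprime (a : ℤ) (Q.derivative.eval n)) :
    rho Q a * (rad a).totient ≤
      ((Finset.range (a * rad a)).filter fun n : ℕ => unitaryDvd a (Q.eval (n : ℤ))).card := by
  rw [aux_rho]
  unfold Nat.totient
  rw [← Finset.card_product]
  have hk := aux_rad_pos a
  have hex : ∀ q : ℕ × ℕ, ∃ t, t < rad a ∧ ((a : ℤ) ∣ Q.eval (q.1 : ℤ) →
      (rad a : ℤ) ∣ (Q.eval (q.1 : ℤ) / a + Q.derivative.eval (q.1 : ℤ) * t) - q.2) := by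
    intro q
    by_cases hq : (a : ℤ) ∣ Q.eval (q.1 : ℤ)
    · have h1 : IsCoprime (rad a : ℤ) (Q.derivative.eval (q.1 : ℤ)) :=
        (hQ _ hq).of_isCoprime_of_dvd_left (Int.natCast_dvd_natCast.mpr (aux_rad_dvd a))
      obtain ⟨s, v, hsv⟩ := h1
      set u := Q.eval (q.1 : ℤ) / a
      have hk' : (0 : ℤ) < rad a := by exact_mod_cast hk
      set w : ℤ := (v * (q.2 - u)) % (rad a : ℤ) with hw
      have hw0 : 0 ≤ w := Int.emod_nonneg _ hk'.ne'
      have hwlt : w < rad a := Int.emod_lt_of_pos _ hk'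
      refine ⟨w.toNat, by omega, fun _ => ?_⟩
      rw [Int.toNat_of_nonneg hw0]
      have h2 := Int.emod_add_mul_ediv (v * (q.2 - u)) (rad a : ℤ)
      rw [← hw] at h2
      refine ⟨-(s * (q.2 - u)) -
        Q.derivative.eval (q.1 : ℤ) * ((v * (q.2 - u)) / (rad a : ℤ)), ?_⟩
      linear_combination (q.2 - u) * hsv + Q.derivative.eval (q.1 : ℤ) * h2
    · exact ⟨0, hk, fun h => absurd h hq⟩
  choose t ht1 ht2 using hex
  refine Finset.card_le_card_of_injOn (fun q => q.1 + a * t q) ?_ ?_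
  · rintro ⟨n, w⟩ hq
    have hq := Finset.mem_product.mp (Finset.mem_coe.mp hq)
    simp only [Finset.mem_filter, Finset.mem_range] at hq
    obtain ⟨⟨hn, hdvd⟩, hw, hcw⟩ := hq
    refine Finset.mem_coe.mpr (Finset.mem_filter.mpr ⟨Finset.mem_range.mpr ?_, ?_⟩)
    · have := ht1 (n, w)
      change n + a * t (n, w) < a * rad a
      calc n + a * t (n, w) < a + a * t (n, w) := by omega
        _ = a * (t (n, w) + 1) := by ring
        _ ≤ _ := Nat.mul_le_mul_left _ this
    · rw [aux_unitary a ha]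
      obtain ⟨z, hz⟩ := ht2 (n, w) hdvd
      obtain ⟨c, hc⟩ := hdvd
      have ha' : (a : ℤ) ≠ 0 := by exact_mod_cast ha.ne'
      simp only at hz
      rw [hc, Int.mul_ediv_cancel_left _ ha'] at hz
      obtain ⟨e, he⟩ := 
        (⟨(Polynomial.binomExpansion Q (n : ℤ) (a * t (n, w))).1,
          (Polynomial.binomExpansion Q (n : ℤ) (a * t (n, w))).2⟩ :
          ∃ e, Q.eval ((n : ℤ) + a * t (n, w)) =
            Q.eval (n : ℤ) + Q.derivative.eval (n : ℤ) * (a * t (n, w)) +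
              e * (a * t (n, w)) ^ 2)
      obtain ⟨b, hb⟩ := aux_rad_dvd a
      have hb' : (a : ℤ) = rad a * b := by exact_mod_cast hb
      refine ⟨w + rad a * (z + b * e * t (n, w) ^ 2), ?_, ?_⟩
      · push_cast
        rw [he, hc]
        linear_combination a * hz + e * a * t (n, w) ^ 2 * hb'
      · apply aux_coprime_rad a ha
        apply IsCoprime.add_mul_left_right
        exact Nat.isCoprime_iff_coprime.mpr hcw
  · rintro ⟨n, w⟩ hq ⟨n', w'⟩ hq' heq
    have hq := Finset.mem_product.mp (Finset.mem_coe.mp hq)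
    have hq' := Finset.mem_product.mp (Finset.mem_coe.mp hq')
    simp only [Finset.mem_filter, Finset.mem_range] at hq hq' heq
    have hn : n = n' := by
      have := congrArg (· % a) heq
      simpa [Nat.mod_eq_of_lt hq.1.1, Nat.mod_eq_of_lt hq'.1.1] using this
    subst hn
    have htt : t (n, w) = t (n, w') :=
      Nat.eq_of_mul_eq_mul_left ha (Nat.add_left_cancel heq)
    have h1 := ht2 (n, w) hq.1.2
    have h2 := ht2 (n, w') hq.1.2
    rw [htt] at h1
    have h3 := dvd_sub h1 h2
    have h4 : w' ≡ w [MOD rad a] := by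
      rw [Nat.modEq_iff_dvd]
      rw [← dvd_neg]
      convert h3 using 1
      ring
    rw [h4.eq_of_lt_of_lt hq'.2.1 hq.2.1]

/-- Inequality (8) of the paper: if `Q₁, …, Q_r` are irreducible, pairwise coprime, and
`Q := ∏_j Q_j` has no fixed prime divisor, `β` is the leading coefficient of `Q` and `D ≠ 0`
is divisible by every prime modulo which `Q` has a repeated root or two of the `Q_j` share a
common root, then for pairwise coprime positive `a₁, …, a_r`, each coprime to `βD`,
`ρ̌(a₁, …, a_r)/∏_j (a_j κ(a_j)) ≥ ∏_j ρ_j(a_j) φ(a_j)/a_j²`. -/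
theorem statement10 (r : ℕ) (hr : 1 ≤ r) (Qs : Fin r → Polynomial ℤ) (D : ℤ)
    (hirr : ∀ j, Irreducible (Qs j))
    (hcop : ∀ i j, i ≠ j → IsRelPrime (Qs i) (Qs j))
    (hnofix : ∀ p : ℕ, p.Prime → rho (∏ j, Qs j) p < p)
    (hD0 : D ≠ 0)
    (hD : ∀ p : ℕ, p.Prime →
      ((∃ n : ℤ, (p : ℤ) ∣ (∏ j, Qs j).eval n ∧
          (p : ℤ) ∣ (Polynomial.derivative (∏ j, Qs j)).eval n) ∨
       (∃ i j : Fin r, i ≠ j ∧ ∃ n : ℤ,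
          (p : ℤ) ∣ (Qs i).eval n ∧ (p : ℤ) ∣ (Qs j).eval n)) →
      (p : ℤ) ∣ D)
    (a : Fin r → ℕ)
    (ha : ∀ j, 0 < a j)
    (hacop : ∀ i j, i ≠ j → Nat.Coprime (a i) (a j))
    (haD : ∀ j, Nat.Coprime (a j) ((∏ j, Qs j).leadingCoeff * D).natAbs) :
    (∏ j, (rho (Qs j) (a j) : ℝ) * (a j).totient / (a j : ℝ) ^ 2) ≤
      (rhoCheck Qs a : ℝ) / ∏ j, ((a j : ℝ) * (rad (a j) : ℝ)) := by
  have hpD : ∀ j, ∀ p : ℕ, p.Prime → p ∣ a j → ¬ (p : ℤ) ∣ D := by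
    intro j p hp hpa hpD
    have h1 : p ∣ ((∏ j, Qs j).leadingCoeff * D).natAbs :=
      Int.natCast_dvd.mp (hpD.mul_left _)
    have h2 := Nat.dvd_gcd hpa h1
    rw [haD j] at h2
    exact hp.one_lt.ne' (Nat.dvd_one.mp h2)
  have hder : ∀ j, ∀ n : ℤ, (a j : ℤ) ∣ (Qs j).eval n →
      IsCoprime (a j : ℤ) ((Qs j).derivative.eval n) := by
    intro j n hn
    apply aux_isCoprime_of_prime
    intro p hp hpa hpd
    apply hpD j p hp hpa
    have hpn : (p : ℤ) ∣ (Qs j).eval n := (Int.natCast_dvd_natCast.mpr hpa).trans hn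
    refine hD p hp (Or.inl ⟨n, ?_, ?_⟩)
    · rw [← Finset.mul_prod_erase _ _ (Finset.mem_univ j), Polynomial.eval_mul]
      exact hpn.mul_right _
    · rw [← Finset.mul_prod_erase _ _ (Finset.mem_univ j), Polynomial.derivative_mul,
        Polynomial.eval_add, Polynomial.eval_mul, Polynomial.eval_mul]
      exact dvd_add (hpd.mul_right _) (hpn.mul_right _)
  have hmain : ∏ j, (rho (Qs j) (a j) * (rad (a j)).totient) ≤ rhoCheck Qs a := by
    rw [aux_rhoCheck]
    refine (Finset.prod_le_prod' fun j _ => aux_local (a j) (ha j) (Qs j) (hder j)).trans ?_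
    have hcrt := aux_crt (fun j => a j * rad (a j))
      (fun j => Nat.mul_pos (ha j) (aux_rad_pos _)) ?_
      (fun j n => unitaryDvd (a j) ((Qs j).eval (n : ℤ)))
      (fun j x y hxy h => aux_unitary_periodic (a j) (ha j) (Qs j) x y hxy h)
    · refine hcrt.trans (Finset.card_le_card ?_)
      intro n hn
      rw [Finset.mem_filter] at hn ⊢
      refine ⟨hn.1, hn.2, ?_⟩
      have hn2 := fun j => (aux_unitary (a j) (ha j) _).mp (hn.2 j)
      choose c hc1 hc2 using hn2
      rw [aux_unitary _ (Finset.prod_pos fun j _ => ha j)]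
      refine ⟨∏ j, c j, ?_, ?_⟩
      · rw [Polynomial.eval_prod]
        push_cast
        rw [← Finset.prod_mul_distrib]
        exact Finset.prod_congr rfl fun j _ => hc1 j
      · push_cast
        refine IsCoprime.prod_left fun i _ => IsCoprime.prod_right fun j _ => ?_
        by_cases hij : i = j
        · subst hij
          exact hc2 i
        · apply aux_isCoprime_of_prime
          intro p hp hpa hpc
          apply hpD i p hp hpa
          refine hD p hp (Or.inr ⟨i, j, hij, n, ?_, ?_⟩)
          · rw [hc1 i]
            exact (Int.natCast_dvd_natCast.mpr hpa).mul_right _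
          · rw [hc1 j]
            exact hpc.mul_left _
    · intro i j hij
      have h := hacop i j hij
      have h1 := h.coprime_dvd_left (aux_rad_dvd (a i))
      exact Nat.Coprime.mul_left
        (Nat.Coprime.mul_right h (h.coprime_dvd_right (aux_rad_dvd _)))
        (Nat.Coprime.mul_right h1 (h1.coprime_dvd_right (aux_rad_dvd _)))
  have hposa : ∀ j, (0 : ℝ) < a j := fun j => by exact_mod_cast ha j
  have hposr : ∀ j, (0 : ℝ) < rad (a j) := fun j => by exact_mod_cast aux_rad_pos (a j)
  rw [le_div_iff₀ (Finset.prod_pos fun j _ => mul_pos (hposa j) (hposr j)),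
    ← Finset.prod_mul_distrib]
  have heq : ∀ j, (rho (Qs j) (a j) : ℝ) * (a j).totient / (a j : ℝ) ^ 2 *
      ((a j : ℝ) * (rad (a j) : ℝ)) = rho (Qs j) (a j) * (rad (a j)).totient := by
    intro j
    have h : ((a j).totient : ℝ) * rad (a j) = (rad (a j)).totient * a j := by
      exact_mod_cast aux_totient (a j)
    have := (hposa j).ne'
    field_simp
    linear_combination (rho (Qs j) (a j) : ℝ) * h
  rw [Finset.prod_congr rfl fun j _ => heq j]
  exact_mod_cast hmain
end
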